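/- arXiv:math/9909110 — 2 statements merged into one kernel-verified Lean document; each statement's English description precedes it below -/
import Mathlib

section
/- For every M ≥ 1 and ε > 0 there is a constant C(M, ε) > 0 depending only on M and ε with the following property. Let (x_j)_{j=1}^n be a sequence of unit vectors in a Hilbert space which is M-Hilbertian. Then there exists a subset σ ⊆ {1,…,n} of cardinality |σ| ≥ C(M, ε) n such that the system (x_j)_{j∈σ} is (1+ε)-equivalent to the canonical basis of l₂^σ, i.e. for all scalars (a_j)_{j∈σ}: (1+ε)^{-1/2} (Σ_{j∈σ} |a_j|²)^{1/2} ≤ ‖Σ_{j∈σ} a_j x_j‖ ≤ (1+ε)^{1/2} (Σ_{j∈σ} |a_j|²)^{1/2}. -/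
open Matrix

/-- Schur complement formula: the inverse of a bordered matrix, with its trace. -/
theorem exists_posSemidef_inv_bordered {ι : Type*} [Fintype ι] [DecidableEq ι]
    {R D : Matrix ι ι ℝ} (hR : R.PosSemidef) (hRD : R * D = 1) (V : Matrix ι Unit ℝ)
    {u p : ℝ} (hp : Vᵀ * R * V = p • (1 : Matrix Unit Unit ℝ)) (hs : 0 < u - p) :
    ∃ Q : Matrix (ι ⊕ Unit) (ι ⊕ Unit) ℝ, Q.PosSemidef ∧
      Q * fromBlocks D (-V) (-Vᵀ) (u • 1) = 1 ∧
      Q.trace = R.trace + (u - p)⁻¹ * ((Vᵀ * (R * R) * V).trace + 1) := by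
  set s := u - p with hsdef
  have hRt : Rᵀ = R := hR.1
  have hs' : s ≠ 0 := hs.ne'
  let E : Matrix (ι ⊕ Unit) ι ℝ := fromRows 1 0
  let W : Matrix (ι ⊕ Unit) Unit ℝ := fromRows (R * V) 1
  have hQ : E * R * Eᵀ + s⁻¹ • (W * Wᵀ) =
      fromBlocks (R + s⁻¹ • (R * V * (Vᵀ * R))) (s⁻¹ • (R * V)) (s⁻¹ • (Vᵀ * R)) (s⁻¹ • 1) := by
    have h0 : (fromRows R (0 : Matrix Unit ι ℝ)).fromCols (0 : Matrix (ι ⊕ Unit) Unit ℝ) =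
        fromBlocks R 0 0 0 := by
      rw [← fromCols_fromRows_eq_fromBlocks, fromRows_zero]
    simp [E, W, fromRows_mul, transpose_fromRows, mul_fromCols, transpose_mul, hRt,
      fromBlocks_smul, h0, fromBlocks_add]
  refine ⟨_, ?_, ?_, congrArg trace hQ |>.trans ?_⟩
  · have h1 := hR.mul_mul_conjTranspose_same E
    have h2 := (posSemidef_self_mul_conjTranspose W).smul (inv_nonneg.2 hs.le)
    rw [conjTranspose_eq_transpose_of_trivial] at h1 h2
    exact h1.add h2
  · rw [hQ, fromBlocks_multiply, ← fromBlocks_one]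
    have hV : R * V * (Vᵀ * R) * V = p • (R * V) := by
      rw [Matrix.mul_assoc, hp]; simp
    congr 1
    · simp [Matrix.add_mul, Matrix.mul_assoc, hRD]
    · simp only [Matrix.mul_neg, Matrix.add_mul, Matrix.smul_mul, hV, Matrix.mul_smul,
        Matrix.mul_one, smul_smul]
      have h1 : -(R * V + (s⁻¹ * p) • (R * V)) + (u * s⁻¹) • (R * V)
          = (-1 - s⁻¹ * p + u * s⁻¹) • (R * V) := by module
      have h0 : -1 - s⁻¹ * p + u * s⁻¹ = 0 := by field_simp; rw [hsdef]; ring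
      rw [h1, h0, zero_smul]
    · simp [Matrix.mul_assoc, hRD]
    · simp only [Matrix.mul_neg, Matrix.smul_mul, hp, Matrix.mul_smul, Matrix.mul_one, smul_smul]
      rw [← neg_smul, ← add_smul]
      have h0 : -(s⁻¹ * p) + u * s⁻¹ = 1 := by field_simp; rw [hsdef]; ring
      rw [h0, one_smul]
  · have h1 : (R * V * (Vᵀ * R)).trace = (Vᵀ * (R * R) * V).trace := by
      rw [trace_mul_comm]; simp only [Matrix.mul_assoc]
    have h2 (A : Matrix ι ι ℝ) (B C) (c : Matrix Unit Unit ℝ) :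
        (fromBlocks A B C c).trace = A.trace + c.trace := by simp [trace]
    rw [h2, trace_add, trace_smul, h1, trace_smul]
    simp
    ring

/-- Shifting a positive matrix by `δ` decreases the trace of its inverse `R` to that of the new
inverse `Q`, with a gain of at least `δ * trace (Q * Q)`. -/
theorem exists_posSemidef_inv_shift {ι : Type*} [Fintype ι] [DecidableEq ι]
    {R D : Matrix ι ι ℝ} (hR : R.PosSemidef) (hRD : R * D = 1) {δ : ℝ} (hδ : 0 < δ) :
    ∃ Q : Matrix ι ι ℝ, Q.PosSemidef ∧ Q * (D + δ • 1) = 1 ∧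
      Q.trace + δ * (Q * Q).trace ≤ R.trace := by
  have hDR : D * R = 1 := mul_eq_one_comm.1 hRD
  have hD : D.PosSemidef := by
    have : D = R⁻¹ := (inv_eq_right_inv hRD).symm
    rw [this]; exact hR.inv
  have hP : (D + δ • 1).PosDef := PosDef.posSemidef_add hD (PosDef.one.smul hδ)
  refine ⟨(D + δ • 1)⁻¹, hP.inv.posSemidef, ?_, ?_⟩
  · exact nonsing_inv_mul _ ((isUnit_iff_isUnit_det _).1 hP.isUnit)
  · have hQ := hP.inv.posSemidef
    have hQD : (D + δ • 1)⁻¹ * (D + δ • 1) = 1 :=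
      nonsing_inv_mul _ ((isUnit_iff_isUnit_det _).1 hP.isUnit)
    set Q := (D + δ • 1)⁻¹
    have h1 : R = Q + δ • (Q * R) := by
      calc R = Q * (D + δ • 1) * R := by rw [hQD, one_mul]
        _ = Q + δ • (Q * R) := by
          rw [Matrix.mul_add, Matrix.add_mul, Matrix.mul_assoc, hDR]; simp
    have h2 : Q * R = Q * Q + δ • (Q * Q * R) := by
      nth_rw 1 [h1]; rw [Matrix.mul_add, Matrix.mul_smul, Matrix.mul_assoc]
    have h3 : 0 ≤ (Q * Q * R).trace := by
      have := (hR.mul_mul_conjTranspose_same Q).trace_nonneg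
      rw [hQ.1, trace_mul_comm, ← Matrix.mul_assoc] at this
      exact this
    have h4 := congrArg trace h1
    have h5 := congrArg trace h2
    rw [trace_add, trace_smul, smul_eq_mul] at h4 h5
    have := mul_nonneg hδ.le (mul_nonneg hδ.le h3)
    nlinarith

theorem sum_sq_submatrix_le {ι κ : Type*} [Fintype ι] [Fintype κ] {S : Matrix κ κ ℝ} {K : ℝ}
    (hS : ∀ a : κ → ℝ, ∑ j, (∑ i, a i * S i j) ^ 2 ≤ K * ∑ i, a i ^ 2)
    (f : ι ↪ κ) (a : ι → ℝ) :
    ∑ j, (∑ i, a i * S (f i) j) ^ 2 ≤ K * ∑ i, a i ^ 2 := by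
  have key : ∀ g : ℝ → κ → ℝ, (∀ j, g 0 j = 0) →
      ∑ j, g (Function.extend f a 0 j) j = ∑ i, g (a i) (f i) := by
    intro g hg
    refine (Fintype.sum_of_injective f f.injective _ _ ?_ ?_).symm
    · intro j hj
      rw [Function.extend_apply' _ _ _ (by simpa using hj)]
      exact hg j
    · intro i
      rw [f.injective.extend_apply]
  have h := hS (Function.extend f a 0)
  rw [key (fun t _ => t ^ 2) (by simp)] at h
  convert h using 4 with j
  exact (key (fun t i => t * S i j) (by simp)).symm

theorem sum_sq_submatrix_submatrix_le {ι κ : Type*} [Fintype ι] [Fintype κ] {S : Matrix κ κ ℝ}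
    {K : ℝ} (hS : ∀ a : κ → ℝ, ∑ j, (∑ i, a i * S i j) ^ 2 ≤ K * ∑ i, a i ^ 2)
    (f : ι ↪ κ) (a : ι → ℝ) :
    ∑ j, (∑ i, a i * S.submatrix f f i j) ^ 2 ≤ K * ∑ i, a i ^ 2 := by
  refine le_trans ?_ (sum_sq_submatrix_le hS f a)
  have := Finset.sum_le_univ_sum_of_nonneg (s := Finset.univ.map f)
    (f := fun j => (∑ i, a i * S (f i) j) ^ 2) (fun _ => sq_nonneg _)
  simpa using this

theorem sum_trace_column_le {ι κ : Type*} [Fintype ι] [DecidableEq ι] [Fintype κ]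
    {S : Matrix κ κ ℝ} {K : ℝ}
    (hS : ∀ a : κ → ℝ, ∑ j, (∑ i, a i * S i j) ^ 2 ≤ K * ∑ i, a i ^ 2)
    (f : ι ↪ κ) {Q : Matrix ι ι ℝ} (hQ : Q.PosSemidef) :
    ∑ j, ((S.submatrix f fun _ : Unit => j)ᵀ * Q * S.submatrix f fun _ : Unit => j).trace
      ≤ K * Q.trace := by
  obtain ⟨m, v, rfl⟩ := posSemidef_iff_eq_sum_vecMulVec.1 hQ
  have h1 (j : κ) : ((S.submatrix f fun _ : Unit => j)ᵀ * (∑ l, vecMulVec (v l) (star (v l))) *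
      S.submatrix f fun _ : Unit => j).trace = ∑ l, (∑ i, v l i * S (f i) j) ^ 2 := by
    rw [Matrix.mul_sum, Matrix.sum_mul, trace_sum]
    refine Finset.sum_congr rfl fun l _ => ?_
    simp [trace, mul_vecMulVec, vecMulVec_mul, vecMulVec_apply, mulVec, vecMul, dotProduct, sq,
      mul_comm]
  have h2 (l : Fin m) : (vecMulVec (v l) (star (v l))).trace = ∑ i, v l i ^ 2 := by
    simp [trace, vecMulVec_apply, sq]
  simp_rw [h1, trace_sum, h2]
  rw [Finset.sum_comm, Finset.mul_sum]
  exact Finset.sum_le_sum fun l _ => sum_sq_submatrix_le hS f (v l)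

/-- Markov's inequality for finite sums, in a form that allows `F = 0`. -/
theorem card_filter_lt_mul_le {κ : Type*} [Fintype κ] {g : κ → ℝ} (hg : ∀ j, 0 ≤ g j)
    {K F c : ℝ} (hK : 0 ≤ K) (hF : 0 ≤ F) (h : ∑ j, g j ≤ K * F) :
    ((Finset.univ.filter fun j => c * F < g j).card : ℝ) * c ≤ K := by
  rcases hF.eq_or_lt with rfl | hF
  · have : ∀ j, g j ≤ 0 := fun j =>
      (Finset.single_le_sum (fun i _ => hg i) (Finset.mem_univ j)).trans (by simpa using h)
    simp [Finset.filter_false_of_mem, this, hK]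
  · have h1 : ((Finset.univ.filter fun j => c * F < g j).card : ℝ) * (c * F) ≤ ∑ j, g j := by
      rw [← nsmul_eq_mul]
      refine (Finset.card_nsmul_le_sum _ g _ fun j hj => ?_).trans
        (Finset.sum_le_univ_sum_of_nonneg hg)
      simp at hj
      exact hj.le
    exact le_of_mul_le_mul_right (by linarith) hF

/-- The barrier argument: as long as the number of chosen indices is a small proportion of all
indices, the chosen family can be enlarged by one index at the cost of shifting the barrier. -/
theorem exists_barrier_certificate {κ : Type*} [Fintype κ] [DecidableEq κ] {S : Matrix κ κ ℝ}
    (hsymm : Sᵀ = S) (hdiag : ∀ i, S i i = 0) {K ε : ℝ} (hK : 0 ≤ K) (hε : 0 < ε)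
    (hS : ∀ a : κ → ℝ, ∑ j, (∑ i, a i * S i j) ^ 2 ≤ K * ∑ i, a i ^ 2)
    {k : ℕ} (hk : k * (1 + 24 * K / ε ^ 2) ≤ Fintype.card κ) (i : ℕ) (hi : i ≤ k) :
    ∃ (ι : Type) (_ : Fintype ι) (_ : DecidableEq ι) (f : ι ↪ κ) (R : Matrix ι ι ℝ),
      Fintype.card ι = i ∧ R.PosSemidef ∧
      R * ((ε / 2 + i * (ε / (2 * k))) • 1 - S.submatrix f f) = 1 ∧
      R.trace ≤ i * (4 / ε) := by
  induction i with
  | zero =>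
    refine ⟨Empty, inferInstance, inferInstance, Function.Embedding.ofIsEmpty, 0, rfl,
      PosSemidef.zero, Subsingleton.elim _ _, by simp⟩
  | succ i ih =>
    obtain ⟨ι, _, _, f, R, hcard, hR, hRD, htr⟩ := ih (by omega)
    have hk0 : (0 : ℝ) < k := by exact_mod_cast (by omega : 0 < k)
    have hik : (i : ℝ) + 1 ≤ k := by exact_mod_cast hi
    set δ := ε / (2 * k) with hδ_def
    have hδ : 0 < δ := by positivity
    obtain ⟨Q, hQ, hQD, hQtr⟩ := exists_posSemidef_inv_shift hR hRD hδ
    have hQQ : (Q * Q).PosSemidef := by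
      have := posSemidef_conjTranspose_mul_self Q
      rwa [hQ.1] at this
    set V : κ → Matrix ι Unit ℝ := fun j => S.submatrix f fun _ => j with hV
    have hVnn {A : Matrix ι ι ℝ} (hA : A.PosSemidef) (j : κ) : 0 ≤ ((V j)ᵀ * A * V j).trace :=
      (hA.conjTranspose_mul_mul_same (V j)).trace_nonneg
    have hp := sum_trace_column_le hS f hQ
    have hq := sum_trace_column_le hS f hQQ
    have hQtr' : Q.trace ≤ k * (4 / ε) := by
      have h1 := mul_nonneg hδ.le hQQ.trace_nonneg
      have h2 : (i : ℝ) * (4 / ε) ≤ k * (4 / ε) := by gcongr; linarith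
      linarith
    set P := Finset.univ.filter fun j => ε / 4 * 1 < ((V j)ᵀ * Q * V j).trace with hPdef
    set T := Finset.univ.filter fun j =>
      δ * ε / 4 * (Q * Q).trace < ((V j)ᵀ * (Q * Q) * V j).trace with hTdef
    have hP : (P.card : ℝ) ≤ 16 * K * k / ε ^ 2 := by
      have := card_filter_lt_mul_le (hVnn hQ) (c := ε / 4) (mul_nonneg hK hQ.trace_nonneg)
        zero_le_one (hp.trans_eq (mul_one _).symm)
      rw [← hPdef] at this
      have h3 : (P.card : ℝ) * (ε / 4) ≤ K * (k * (4 / ε)) :=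
        this.trans (mul_le_mul_of_nonneg_left hQtr' hK)
      rw [← le_div_iff₀ (by positivity)] at h3
      refine h3.trans_eq ?_
      field_simp
      ring
    have hT : (T.card : ℝ) ≤ 8 * K * k / ε ^ 2 := by
      have h3 := card_filter_lt_mul_le (hVnn hQQ) (c := δ * ε / 4) hK hQQ.trace_nonneg hq
      rw [← hTdef, ← le_div_iff₀ (by positivity)] at h3
      refine h3.trans_eq ?_
      rw [hδ_def]
      field_simp
      ring
    obtain ⟨j, hj⟩ : ∃ j, j ∉ (Finset.univ.map f ∪ P) ∪ T := by
      by_contra! hall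
      have h1 : Fintype.card κ ≤ i + P.card + T.card := by
        calc Fintype.card κ = ((Finset.univ.map f ∪ P) ∪ T).card := by
              rw [Finset.eq_univ_iff_forall.2 hall, Finset.card_univ]
          _ ≤ (Finset.univ.map f).card + P.card + T.card :=
              (Finset.card_union_le _ _).trans (by gcongr; exact Finset.card_union_le _ _)
          _ = i + P.card + T.card := by simp [hcard]
      have h2 : (Fintype.card κ : ℝ) ≤ i + P.card + T.card := by exact_mod_cast h1
      have h3 : (k : ℝ) * (1 + 24 * K / ε ^ 2) =
          k + 16 * K * k / ε ^ 2 + 8 * K * k / ε ^ 2 := by ring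
      linarith
    simp only [Finset.mem_union, not_or, hPdef, hTdef, Finset.mem_filter, Finset.mem_univ,
      true_and, not_lt, Finset.mem_map, not_exists, mul_one] at hj
    obtain ⟨⟨hjf, hjp⟩, hjq⟩ := hj
    set p := ((V j)ᵀ * Q * V j).trace with hp_def
    have hpV : (V j)ᵀ * Q * V j = p • (1 : Matrix Unit Unit ℝ) := by
      ext a b; simp [hp_def, trace]
    set u := ε / 2 + ((i + 1 : ℕ) : ℝ) * δ with hu
    have hu2 : ε / 2 ≤ u := by
      have : 0 ≤ ((i + 1 : ℕ) : ℝ) * δ := by positivity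
      linarith
    have hs : ε / 4 ≤ u - p := by linarith
    have hs0 : 0 < u - p := by linarith [div_pos hε four_pos]
    obtain ⟨Q', hQ', hQD', hQtr''⟩ := exists_posSemidef_inv_bordered hQ hQD (V j) hpV hs0
    refine ⟨ι ⊕ Unit, inferInstance, inferInstance,
      ⟨Sum.elim f fun _ => j, f.injective.sumElim (fun _ _ _ => rfl) fun a _ => hjf a⟩, Q',
      by simp [hcard], hQ', ?_, ?_⟩
    · convert hQD' using 2
      have hsy (a b) : S a b = S b a := congrFun (congrFun hsymm b) a
      ext (a | a) (b | b)
      · simp [hu, Matrix.one_apply]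
        split_ifs <;> ring
      · simp [hV]
      · simp [hV, hsy]
      · simp [hdiag]
    · rw [hQtr'']
      have h1 : (u - p)⁻¹ ≤ 4 / ε := by
        rw [← inv_div]; exact inv_anti₀ (by positivity) hs
      have h2 : (u - p)⁻¹ * (((V j)ᵀ * (Q * Q) * V j).trace + 1) ≤
          4 / ε * (δ * ε / 4 * (Q * Q).trace + 1) := by
        have := hVnn hQQ j
        gcongr
      have h3 : 4 / ε * (δ * ε / 4 * (Q * Q).trace + 1) = δ * (Q * Q).trace + 4 / ε := by
        field_simp
      push_cast
      linarith

/-- One-sided restricted bound for zero-diagonal symmetric matrices: a proportional principal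
submatrix is at most `ε`. -/
theorem exists_submatrix_le_smul_one {κ : Type*} [Fintype κ] [DecidableEq κ] {S : Matrix κ κ ℝ}
    (hsymm : Sᵀ = S) (hdiag : ∀ i, S i i = 0) {K ε : ℝ} (hK : 0 ≤ K) (hε : 0 < ε)
    (hS : ∀ a : κ → ℝ, ∑ j, (∑ i, a i * S i j) ^ 2 ≤ K * ∑ i, a i ^ 2) :
    ∃ (ι : Type) (_ : Fintype ι) (_ : DecidableEq ι) (f : ι ↪ κ),
      (2 * (1 + 24 * K / ε ^ 2))⁻¹ * (Fintype.card κ : ℝ) ≤ (Fintype.card ι : ℝ) ∧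
      (ε • 1 - S.submatrix f f).PosSemidef := by
  set L := 1 + 24 * K / ε ^ 2 with hL
  have hL1 : 1 ≤ L := le_add_of_nonneg_right (by positivity)
  set N : ℝ := (Fintype.card κ : ℝ) with hN
  have hN0 : 0 ≤ N := by positivity
  rcases lt_or_ge N L with hNL | hNL
  · rcases isEmpty_or_nonempty κ with hκ | ⟨⟨j⟩⟩
    · refine ⟨Empty, inferInstance, inferInstance, Function.Embedding.ofIsEmpty, by simp [hN], ?_⟩
      rw [Subsingleton.elim (ε • 1 - S.submatrix _ _) 0]
      exact PosSemidef.zero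
    · refine ⟨Unit, inferInstance, inferInstance, ⟨fun _ => j, fun _ _ _ => rfl⟩, ?_, ?_⟩
      · rw [inv_mul_le_iff₀ (by positivity)]
        simp
        linarith
      · convert (PosSemidef.one (n := Unit) (R := ℝ)).smul hε.le using 1
        ext
        simp [hdiag]
  · have hfl : (⌊N / L⌋₊ : ℝ) * L ≤ N := by
      rw [← le_div_iff₀ (by linarith)]
      exact Nat.floor_le (by positivity)
    have hk1 : 1 ≤ ⌊N / L⌋₊ := by
      rw [Nat.one_le_floor_iff, one_le_div (by linarith)]
      exact hNL
    obtain ⟨ι, hι, hι', f, R, hcard, hR, hRD, -⟩ :=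
      exists_barrier_certificate hsymm hdiag hK hε hS hfl _ le_rfl
    refine ⟨ι, hι, hι', f, ?_, ?_⟩
    · rw [hcard, inv_mul_le_iff₀ (by positivity)]
      have h1 := Nat.lt_floor_add_one (N / L)
      rw [div_lt_iff₀ (by linarith)] at h1
      have h2 : (1 : ℝ) ≤ ⌊N / L⌋₊ := by exact_mod_cast hk1
      nlinarith
    · have h0 : (⌊N / L⌋₊ : ℝ) ≠ 0 := by positivity
      have h1 : ε / 2 + (⌊N / L⌋₊ : ℝ) * (ε / (2 * ⌊N / L⌋₊)) = ε := by
        field_simp; ring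
      rw [h1] at hRD
      rw [← inv_eq_right_inv hRD]
      exact hR.inv

/-- Two-sided version of `exists_submatrix_le_smul_one`. -/
theorem exists_submatrix_abs_le_smul_one {κ : Type*} [Fintype κ] [DecidableEq κ]
    {S : Matrix κ κ ℝ} (hsymm : Sᵀ = S) (hdiag : ∀ i, S i i = 0) {K ε : ℝ} (hK : 0 ≤ K)
    (hε : 0 < ε) (hS : ∀ a : κ → ℝ, ∑ j, (∑ i, a i * S i j) ^ 2 ≤ K * ∑ i, a i ^ 2) :
    ∃ (ι : Type) (_ : Fintype ι) (_ : DecidableEq ι) (f : ι ↪ κ),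
      ((2 * (1 + 24 * K / ε ^ 2))⁻¹) ^ 2 * (Fintype.card κ : ℝ) ≤ (Fintype.card ι : ℝ) ∧
      (ε • 1 - S.submatrix f f).PosSemidef ∧ (ε • 1 + S.submatrix f f).PosSemidef := by
  obtain ⟨ι, _, _, f, hcard, hf⟩ := exists_submatrix_le_smul_one hsymm hdiag hK hε hS
  obtain ⟨ι', hι', hι'', g, hcard', hg⟩ := exists_submatrix_le_smul_one
    (S := -S.submatrix f f) (by simp [hsymm]) (by simp [hdiag]) hK hε
    (fun a => by simpa using sum_sq_submatrix_submatrix_le hS f a)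
  refine ⟨ι', hι', hι'', g.trans f, ?_, ?_, ?_⟩
  · rw [sq, mul_assoc]
    exact (mul_le_mul_of_nonneg_left hcard (by positivity)).trans hcard'
  · convert hf.submatrix g using 1
    ext a b
    simp [Matrix.one_apply]
  · convert hg using 1
    ext a b
    simp

theorem sum_inner_sq_le {H κ : Type*} [NormedAddCommGroup H] [InnerProductSpace ℝ H] [Fintype κ]
    {x : κ → H} {M : ℝ} (hx : ∀ a : κ → ℝ, ‖∑ j, a j • x j‖ ≤ M * √(∑ j, a j ^ 2)) (y : H) :
    ∑ j, inner ℝ y (x j) ^ 2 ≤ M ^ 2 * ‖y‖ ^ 2 := by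
  set B := ∑ j, inner ℝ y (x j) ^ 2 with hB
  have hB0 : 0 ≤ B := Finset.sum_nonneg fun _ _ => sq_nonneg _
  have h1 : B = inner ℝ y (∑ j, inner ℝ y (x j) • x j) := by
    simp [inner_sum, inner_smul_right, hB, sq]
  have h2 : B ≤ ‖y‖ * (M * √B) :=
    h1.le.trans ((real_inner_le_norm _ _).trans
      (mul_le_mul_of_nonneg_left (hx _) (norm_nonneg _)))
  have h3 : √B ^ 2 = B := Real.sq_sqrt hB0
  rcases (Real.sqrt_nonneg B).eq_or_lt with h | h
  · rw [(Real.sqrt_eq_zero hB0).1 h.symm]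
    positivity
  · have h4 : √B ≤ ‖y‖ * M := le_of_mul_le_mul_right (by nlinarith) h
    calc B = √B ^ 2 := h3.symm
      _ ≤ (‖y‖ * M) ^ 2 := by gcongr
      _ = M ^ 2 * ‖y‖ ^ 2 := by ring

theorem sum_sq_gram_sub_one_le {H κ : Type*} [NormedAddCommGroup H] [InnerProductSpace ℝ H]
    [Fintype κ] [DecidableEq κ] {x : κ → H} {M : ℝ}
    (hx : ∀ a : κ → ℝ, ‖∑ j, a j • x j‖ ≤ M * √(∑ j, a j ^ 2)) (a : κ → ℝ) :
    ∑ j, (∑ i, a i * (gram ℝ x - 1) i j) ^ 2 ≤ (2 * M ^ 4 + 2) * ∑ i, a i ^ 2 := by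
  set y := ∑ i, a i • x i with hy
  have h1 (j : κ) : ∑ i, a i * (gram ℝ x - 1) i j = inner ℝ y (x j) - a j := by
    simp [hy, sum_inner, inner_smul_left, mul_sub, Matrix.one_apply]
  have h2 : ‖y‖ ^ 2 ≤ M ^ 2 * ∑ i, a i ^ 2 := by
    have := pow_le_pow_left₀ (norm_nonneg _) (hx a) 2
    rwa [mul_pow, Real.sq_sqrt (Finset.sum_nonneg fun _ _ => sq_nonneg _)] at this
  calc ∑ j, (∑ i, a i * (gram ℝ x - 1) i j) ^ 2
      ≤ ∑ j, (2 * inner ℝ y (x j) ^ 2 + 2 * a j ^ 2) := by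
        refine Finset.sum_le_sum fun j _ => ?_
        rw [h1]
        nlinarith [sq_nonneg (inner ℝ y (x j) + a j)]
    _ = 2 * ∑ j, inner ℝ y (x j) ^ 2 + 2 * ∑ j, a j ^ 2 := by
        rw [Finset.sum_add_distrib, Finset.mul_sum, Finset.mul_sum]
    _ ≤ 2 * (M ^ 2 * (M ^ 2 * ∑ i, a i ^ 2)) + 2 * ∑ j, a j ^ 2 := by
        gcongr
        exact (sum_inner_sq_le hx y).trans (by gcongr)
    _ = (2 * M ^ 4 + 2) * ∑ i, a i ^ 2 := by ring

/-- For every `M ≥ 1` and `ε > 0` there is `C(M,ε) > 0` such that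
every normalized `M`-Hilbertian sequence `(x j)_{j ≤ n}` in a Hilbert space has a subset
`σ` of cardinality `|σ| ≥ C(M,ε) n` on which it is `(1+ε)`-equivalent to the canonical
basis of `l₂^σ`. -/
theorem hilbertian_almost_orthonormal_subset :
    ∀ M : ℝ, 1 ≤ M → ∀ ε : ℝ, 0 < ε → ∃ C : ℝ, 0 < C ∧
      ∀ (H : Type) [NormedAddCommGroup H] [InnerProductSpace ℝ H],
      ∀ (n : ℕ) (x : Fin n → H), (∀ j, ‖x j‖ = 1) →
      (∀ a : Fin n → ℝ, ‖∑ j, a j • x j‖ ≤ M * Real.sqrt (∑ j, (a j) ^ 2)) →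
      ∃ σ : Finset (Fin n), C * n ≤ σ.card ∧
        ∀ a : Fin n → ℝ,
          (Real.sqrt (1 + ε))⁻¹ * Real.sqrt (∑ j ∈ σ, (a j) ^ 2)
              ≤ ‖∑ j ∈ σ, a j • x j‖ ∧
          ‖∑ j ∈ σ, a j • x j‖ ≤ Real.sqrt (1 + ε) * Real.sqrt (∑ j ∈ σ, (a j) ^ 2) := by
  intro M _ ε hε
  set η := ε / (1 + ε) with hη_def
  have hη : 0 < η := by positivity
  have hη1 : 1 - η = (1 + ε)⁻¹ := by rw [hη_def]; field_simp; ring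
  have hη2 : η ≤ ε := div_le_self hε.le (by linarith)
  refine ⟨((2 * (1 + 24 * (2 * M ^ 4 + 2) / η ^ 2))⁻¹) ^ 2, by positivity, ?_⟩
  intro H _ _ n x hx1 hx
  obtain ⟨ι, _, _, f, hcard, hup, hlow⟩ := exists_submatrix_abs_le_smul_one
    (S := gram ℝ x - 1) (by ext i j; simp [Matrix.one_apply, real_inner_comm, eq_comm])
    (by simp [hx1]) (K := 2 * M ^ 4 + 2) (by positivity) hη (sum_sq_gram_sub_one_le hx)
  refine ⟨Finset.univ.map f, by simpa using hcard, fun a => ?_⟩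
  simp only [Finset.sum_map]
  set A := ∑ i, a (f i) ^ 2 with hA
  have hA0 : 0 ≤ A := Finset.sum_nonneg fun _ _ => sq_nonneg _
  set y := ∑ i, a (f i) • x (f i) with hy
  have hform : (a ∘ f) ⬝ᵥ ((gram ℝ x - 1).submatrix f f *ᵥ (a ∘ f)) = ‖y‖ ^ 2 - A := by
    rw [← real_inner_self_eq_norm_sq, hy, sum_inner, hA, ← Finset.sum_sub_distrib, dotProduct]
    refine Finset.sum_congr rfl fun i _ => ?_
    simp [mulVec, dotProduct, inner_sum, inner_smul_left, inner_smul_right,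
      Matrix.one_apply, mul_sub, sq, mul_comm, Finset.mul_sum, mul_left_comm]
  have hone : (a ∘ f) ⬝ᵥ ((η • (1 : Matrix ι ι ℝ)) *ᵥ (a ∘ f)) = η * A := by
    simp [smul_mulVec, dotProduct, hA, sq, Finset.mul_sum, mul_left_comm]
  have h1 := hup.dotProduct_mulVec_nonneg (a ∘ f)
  have h2 := hlow.dotProduct_mulVec_nonneg (a ∘ f)
  rw [star_trivial, sub_mulVec, dotProduct_sub, hone, hform] at h1
  rw [star_trivial, add_mulVec, dotProduct_add, hone, hform] at h2
  constructor
  · rw [← Real.sqrt_inv, ← Real.sqrt_mul (by positivity), ← hη1]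
    exact Real.sqrt_le_iff.2 ⟨norm_nonneg _, by linarith⟩
  · rw [← Real.sqrt_mul (by positivity)]
    refine Real.le_sqrt_of_sq_le ?_
    nlinarith
end

section
/- For every a > 0 there are constants C₁(a), C₂(a) > 0 depending only on a with the following property. Let n ≥ 2 and let X = (ℝⁿ, ‖·‖_X) be an n-dimensional Banach space whose volume ratio satisfies vr(X) ≥ a √n, i.e. for every ellipsoid E contained in the unit ball B_X one has (Vol(B_X)/Vol(E))^{1/n} ≥ a √n. Then there exists a linear subspace Z ⊆ X of dimension m ≥ C₁(a) √n whose Banach–Mazur distance to l_∞^m is at most C₂(a) log n. -/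
open MeasureTheory
open scoped BigOperators

/-! ### A derivative estimate at the origin for bounded polynomials -/

/-- For `z ≠ 0` this is `z ^ d` times the value of the polynomial `∑ cⱼ xʲ` at
`x = (z - z⁻¹) / (2 i)`. -/
noncomputable def laurentLift (c : ℕ → ℝ) (d : ℕ) (z : ℂ) : ℂ :=
  ∑ j ∈ Finset.range (d + 1), (c j : ℂ) * ((z ^ 2 - 1) / (2 * Complex.I)) ^ j * z ^ (d - j)

lemma differentiable_laurentLift (c : ℕ → ℝ) (d : ℕ) : Differentiable ℂ (laurentLift c d) := by
  unfold laurentLift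
  fun_prop

lemma norm_laurentLift_le_of_norm_le_one {c : ℕ → ℝ} {d : ℕ} {M : ℝ}
    (h : ∀ x ∈ Set.Icc (-1 : ℝ) 1, |∑ j ∈ Finset.range (d + 1), c j * x ^ j| ≤ M)
    {z : ℂ} (hz : ‖z‖ ≤ 1) : ‖laurentLift c d z‖ ≤ M := by
  refine Complex.norm_le_of_forall_mem_frontier_norm_le (U := Metric.ball (0 : ℂ) 1)
    Metric.isBounded_ball (differentiable_laurentLift c d).diffContOnCl ?_ ?_
  · intro w hw
    rw [frontier_ball _ one_ne_zero] at hw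
    have hw1 : ‖w‖ = 1 := by simpa using hw
    have hconj : w * (starRingEnd ℂ) w = 1 := by
      rw [Complex.mul_conj, Complex.normSq_eq_norm_sq, hw1]; simp
    have hs : (w ^ 2 - 1) / (2 * Complex.I) = w * (w.im : ℂ) := by
      rw [div_eq_iff (by simp)]
      have := Complex.sub_conj w
      calc w ^ 2 - 1 = w * (w - (starRingEnd ℂ) w) := by rw [mul_sub, hconj]; ring
        _ = _ := by rw [this]; push_cast; ring
    have : laurentLift c d w
        = ((∑ j ∈ Finset.range (d + 1), c j * w.im ^ j : ℝ) : ℂ) * w ^ d := by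
      unfold laurentLift
      push_cast
      rw [Finset.sum_mul]
      refine Finset.sum_congr rfl fun j hj => ?_
      have hjd : j ≤ d := by simpa [Nat.lt_succ_iff] using hj
      rw [hs, mul_pow, ← Nat.add_sub_cancel' hjd, pow_add]
      simp only [Nat.add_sub_cancel_left]
      ring
    rw [this, norm_mul, norm_pow, hw1, one_pow, mul_one, Complex.norm_real]
    refine h _ (abs_le.mp ?_)
    exact (Complex.abs_im_le_norm w).trans hw1.le
  · rw [closure_ball _ one_ne_zero]
    simpa using hz

lemma norm_laurentLift_le {c : ℕ → ℝ} {d : ℕ} {M : ℝ}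
    (h : ∀ x ∈ Set.Icc (-1 : ℝ) 1, |∑ j ∈ Finset.range (d + 1), c j * x ^ j| ≤ M)
    {z : ℂ} {r : ℝ} (hr : 1 ≤ r) (hz : ‖z‖ ≤ r) : ‖laurentLift c d z‖ ≤ M * r ^ (2 * d) := by
  have hM : 0 ≤ M := (abs_nonneg _).trans (h 0 (by simp))
  rcases le_total ‖z‖ 1 with h1 | h1
  · exact (norm_laurentLift_le_of_norm_le_one h h1).trans
      (le_mul_of_one_le_right hM (one_le_pow₀ hr))
  have hz0 : z ≠ 0 := norm_pos_iff.mp (by linarith)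
  have key : laurentLift c d z
      = z ^ (2 * d) * laurentLift (fun j => (-1) ^ j * c j) d z⁻¹ := by
    unfold laurentLift
    rw [Finset.mul_sum]
    refine Finset.sum_congr rfl fun j hj => ?_
    have hjd : j ≤ d := by simpa [Nat.lt_succ_iff] using hj
    obtain ⟨e, rfl⟩ := Nat.exists_eq_add_of_le hjd
    have h1 : (z⁻¹ ^ 2 - 1) / (2 * Complex.I)
        = (-1) * ((z ^ 2 - 1) / (2 * Complex.I)) * (z⁻¹) ^ 2 := by
      field_simp
      ring
    rw [h1, mul_pow, mul_pow, Nat.add_sub_cancel_left]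
    push_cast
    have h2 : ((-1 : ℂ) ^ j) * (-1) ^ j = 1 := by rw [← mul_pow]; simp
    have h3 : z ^ (2 * (j + e)) * ((z⁻¹ ^ 2) ^ j * z⁻¹ ^ e) = z ^ e := by
      calc _ = (z * z⁻¹) ^ (2 * j) * (z * z⁻¹) ^ e * z ^ e := by ring
        _ = z ^ e := by rw [mul_inv_cancel₀ hz0]; simp
    calc _ = ↑(c j) * ((z ^ 2 - 1) / (2 * Complex.I)) ^ j
          * (z ^ (2 * (j + e)) * ((z⁻¹ ^ 2) ^ j * z⁻¹ ^ e)) := by rw [h3]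
      _ = ((-1 : ℂ) ^ j * (-1) ^ j) * (↑(c j) * ((z ^ 2 - 1) / (2 * Complex.I)) ^ j
          * (z ^ (2 * (j + e)) * ((z⁻¹ ^ 2) ^ j * z⁻¹ ^ e))) := by rw [h2, one_mul]
      _ = _ := by ring
  rw [key, norm_mul, norm_pow, mul_comm]
  gcongr
  refine norm_laurentLift_le_of_norm_le_one (M := M) ?_ ?_
  · intro x hx
    have := h (-x) ⟨by linarith [hx.2], by linarith [hx.1]⟩
    have he : ∑ j ∈ Finset.range (d + 1), (-1) ^ j * c j * x ^ j
        = ∑ j ∈ Finset.range (d + 1), c j * (-x) ^ j :=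
      Finset.sum_congr rfl fun j _ => by rw [neg_pow x]; ring
    rw [he]
    exact this
  · rw [norm_inv]
    exact inv_le_one_of_one_le₀ h1

lemma deriv_laurentLift_one (c : ℕ → ℝ) {d : ℕ} (hd : 1 ≤ d) :
    deriv (laurentLift c d) 1 = (d : ℂ) * c 0 + c 1 / Complex.I := by
  have hterm : ∀ j : ℕ, HasDerivAt
      (fun z : ℂ => (c j : ℂ) * ((z ^ 2 - 1) / (2 * Complex.I)) ^ j * z ^ (d - j))
      ((c j : ℂ) * (((j : ℂ) * (((1 : ℂ) ^ 2 - 1) / (2 * Complex.I)) ^ (j - 1)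
        * (((2 : ℕ) * (1 : ℂ) ^ (2 - 1)) / (2 * Complex.I))))
          * (1 : ℂ) ^ (d - j) + (c j : ℂ) * (((1 : ℂ) ^ 2 - 1) / (2 * Complex.I)) ^ j
          * (((d - j : ℕ) : ℂ) * 1 ^ (d - j - 1))) 1 := by
    intro j
    exact (((((hasDerivAt_pow 2 (1 : ℂ)).sub_const 1).div_const _).pow j).const_mul _).mul
      (hasDerivAt_pow (d - j) (1 : ℂ))
  have hsum := HasDerivAt.fun_sum (u := Finset.range (d + 1)) fun j _ => hterm j
  have : deriv (laurentLift c d) 1 = _ := hsum.deriv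
  rw [this]
  obtain ⟨e, rfl⟩ := Nat.exists_eq_add_of_le' hd
  rw [Finset.sum_range_succ', Finset.sum_range_succ']
  have hz : ∑ k ∈ Finset.range e, ((c (k + 1 + 1) : ℂ)
      * (((k + 1 + 1 : ℕ) : ℂ) * (((1 : ℂ) ^ 2 - 1) / (2 * Complex.I)) ^ (k + 1 + 1 - 1)
        * (((2 : ℕ) * (1 : ℂ) ^ (2 - 1)) / (2 * Complex.I)))
          * (1 : ℂ) ^ (e + 1 - (k + 1 + 1)) + (c (k + 1 + 1) : ℂ)
          * (((1 : ℂ) ^ 2 - 1) / (2 * Complex.I)) ^ (k + 1 + 1)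
          * (((e + 1 - (k + 1 + 1) : ℕ) : ℂ) * 1 ^ (e + 1 - (k + 1 + 1) - 1))) = 0 := by
    refine Finset.sum_eq_zero fun k _ => ?_
    simp
  rw [hz]
  simp only [div_eq_mul_inv, mul_inv, Complex.inv_I]
  simp
  ring

/-- A polynomial of degree at most `d` bounded by `M` on `[-1, 1]` has linear coefficient
at most `10 d M`. -/
lemma abs_linear_coeff_le {c : ℕ → ℝ} {d : ℕ} (hd : 1 ≤ d) {M : ℝ}
    (h : ∀ x ∈ Set.Icc (-1 : ℝ) 1, |∑ j ∈ Finset.range (d + 1), c j * x ^ j| ≤ M) :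
    |c 1| ≤ 10 * d * M := by
  have hd0 : (0 : ℝ) < d := by exact_mod_cast hd
  have hM : 0 ≤ M := (abs_nonneg _).trans (h 0 (by simp))
  have hc0 : |c 0| ≤ M := by
    have := h 0 (by simp)
    rw [Finset.sum_range_succ'] at this
    simpa using this
  have hexp : (1 + 1 / (d : ℝ)) ^ (2 * d) ≤ 9 := by
    calc (1 + 1 / (d : ℝ)) ^ (2 * d) ≤ (Real.exp (1 / d)) ^ (2 * d) := by
          gcongr
          linarith [Real.add_one_le_exp (1 / (d : ℝ))]
      _ = (Real.exp 1) ^ 2 := by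
          rw [← Real.exp_nat_mul, ← Real.exp_nat_mul]
          congr 1
          push_cast
          field_simp
      _ ≤ 3 ^ 2 := by
          gcongr
          linarith [Real.exp_one_lt_d9]
      _ = 9 := by norm_num
  have hder : ‖deriv (laurentLift c d) 1‖ ≤ (9 * M) / (1 / d) := by
    refine Complex.norm_deriv_le_of_forall_mem_sphere_norm_le (by positivity)
      (differentiable_laurentLift c d).diffContOnCl ?_
    intro z hz
    have hz' : ‖z‖ ≤ 1 + 1 / d := by
      have h1 : ‖z - 1‖ = 1 / d := by simpa using hz
      calc ‖z‖ = ‖1 + (z - 1)‖ := by ring_nf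
        _ ≤ ‖(1 : ℂ)‖ + ‖z - 1‖ := norm_add_le _ _
        _ = _ := by rw [h1]; simp
    have hr : (1 : ℝ) ≤ 1 + 1 / d := by
      have : (0 : ℝ) ≤ 1 / d := by positivity
      linarith
    calc ‖laurentLift c d z‖ ≤ M * (1 + 1 / (d : ℝ)) ^ (2 * d) := norm_laurentLift_le h hr hz'
      _ ≤ M * 9 := by gcongr
      _ = 9 * M := by ring
  rw [deriv_laurentLift_one c hd] at hder
  have h1 : (c 1 : ℂ) / Complex.I = ((d : ℂ) * c 0 + c 1 / Complex.I) - (d : ℂ) * c 0 := by ring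
  have h2 : |c 1| = ‖(c 1 : ℂ) / Complex.I‖ := by simp
  rw [h2, h1]
  refine (norm_sub_le _ _).trans ?_
  have h3 : ‖(d : ℂ) * c 0‖ = d * |c 0| := by simp
  rw [h3]
  have h4 : (9 * M) / (1 / d) = 9 * M * d := by field_simp
  rw [h4] at hder
  nlinarith

/-- A polynomial bounded by `1` on `[-1, 1]` with all coefficients at most `2 ^ d` has linear
coefficient at most `40 d`. -/
lemma abs_linear_coeff_le_of_coeff_le {c : ℕ → ℝ} {d k : ℕ} (hd : 1 ≤ d) (hk : 1 ≤ k)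
    (h : ∀ x ∈ Set.Icc (-1 : ℝ) 1, |∑ j ∈ Finset.range (k + 1), c j * x ^ j| ≤ 1)
    (hc : ∀ j, |c j| ≤ 2 ^ d) : |c 1| ≤ 40 * d := by
  rcases le_total k d with hkd | hkd
  · have := abs_linear_coeff_le hk h
    have hkd' : (k : ℝ) ≤ d := by exact_mod_cast hkd
    have : (0 : ℝ) ≤ d := by positivity
    linarith
  have key : ∀ x ∈ Set.Icc (-1 : ℝ) 1,
      |∑ j ∈ Finset.range (d + 1), (c j * (1 / 2) ^ j) * x ^ j| ≤ 2 := by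
    intro x hx
    have hx1 : |x| ≤ 1 := abs_le.mpr hx
    have h1 := h (x / 2) ⟨by linarith [hx.1], by linarith [hx.2]⟩
    have hsplit : ∑ j ∈ Finset.range (k + 1), c j * (x / 2) ^ j
        = ∑ j ∈ Finset.range (d + 1), (c j * (1 / 2) ^ j) * x ^ j
          + ∑ i ∈ Finset.range (k - d), c (d + 1 + i) * (x / 2) ^ (d + 1 + i) := by
      have : k + 1 = (d + 1) + (k - d) := by omega
      rw [this, Finset.sum_range_add]
      congr 1
      refine Finset.sum_congr rfl fun j _ => ?_
      rw [div_pow, one_div, inv_pow]; ring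
    have htail : |∑ i ∈ Finset.range (k - d), c (d + 1 + i) * (x / 2) ^ (d + 1 + i)| ≤ 1 := by
      calc _ ≤ ∑ i ∈ Finset.range (k - d), |c (d + 1 + i) * (x / 2) ^ (d + 1 + i)| :=
            Finset.abs_sum_le_sum_abs _ _
        _ ≤ ∑ i ∈ Finset.range (k - d), (1 / 2 : ℝ) ^ i * (1 / 2) := by
            refine Finset.sum_le_sum fun i _ => ?_
            rw [abs_mul, abs_pow]
            have hx2 : |x / 2| ≤ 1 / 2 := by
              rw [abs_div, abs_two]; linarith
            calc _ ≤ (2 : ℝ) ^ d * (1 / 2) ^ (d + 1 + i) := by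
                  gcongr
                  exact hc _
              _ = ((2 : ℝ) * (1 / 2)) ^ d * ((1 / 2) ^ i * (1 / 2)) := by
                  rw [mul_pow]; ring
              _ = _ := by norm_num
        _ = (∑ i ∈ Finset.range (k - d), (1 / 2 : ℝ) ^ i) * (1 / 2) := by
            rw [Finset.sum_mul]
        _ ≤ 2 * (1 / 2) := by
            gcongr
            exact sum_geometric_two_le _
        _ = 1 := by norm_num
    rw [hsplit] at h1
    rw [abs_le] at h1 htail ⊢
    constructor <;> linarith [h1.1, h1.2, htail.1, htail.2]
  have h2 := abs_linear_coeff_le (c := fun j => c j * (1 / 2) ^ j) hd key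
  simp only [pow_one, abs_mul] at h2
  rw [abs_of_pos (by norm_num : (0 : ℝ) < 1 / 2)] at h2
  linarith
/-! ### Walsh functions and the Rademacher projection -/

/-- The real number `±1` attached to a sign. -/
def signVal (u : ℤˣ) : ℝ := ((u : ℤ) : ℝ)

lemma signVal_one : signVal 1 = 1 := by simp [signVal]

lemma signVal_neg_one : signVal (-1) = -1 := by simp [signVal]

lemma signVal_mul_self (u : ℤˣ) : signVal u * signVal u = 1 := by
  rcases Int.units_eq_one_or u with rfl | rfl <;> simp [signVal]

lemma abs_signVal (u : ℤˣ) : |signVal u| = 1 := by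
  rcases Int.units_eq_one_or u with rfl | rfl <;> simp [signVal]

section Walsh

variable {κ : Type*} [Fintype κ]

/-- The Walsh function of a finite set of coordinates of the sign cube. -/
def walsh (S : Finset κ) (ε : κ → ℤˣ) : ℝ := ∏ i ∈ S, signVal (ε i)

lemma prod_one_add_eq_sum_walsh (ρ : ℝ) (ε η : κ → ℤˣ) :
    ∏ i, (1 + ρ * (signVal (ε i) * signVal (η i)))
      = ∑ j ∈ Finset.range (Fintype.card κ + 1),
          (∑ S ∈ Finset.powersetCard j Finset.univ, walsh S ε * walsh S η) * ρ ^ j := by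
  rw [Finset.prod_one_add, Finset.sum_powerset, Finset.card_univ]
  refine Finset.sum_congr rfl fun j _ => ?_
  rw [Finset.sum_mul]
  refine Finset.sum_congr rfl fun S hS => ?_
  rw [Finset.prod_mul_distrib, Finset.prod_const, Finset.prod_mul_distrib,
    (Finset.mem_powersetCard.mp hS).2]
  simp only [walsh]
  ring

lemma prod_one_add_signVal (ε η : κ → ℤˣ) :
    ∏ i, (1 + signVal (ε i) * signVal (η i)) = if ε = η then 2 ^ Fintype.card κ else 0 := by
  split_ifs with h
  · subst h
    simp only [signVal_mul_self]
    norm_num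
  · obtain ⟨i, hi⟩ := Function.ne_iff.mp h
    refine Finset.prod_eq_zero (Finset.mem_univ i) ?_
    rcases Int.units_eq_one_or (ε i) with h1 | h1 <;>
      rcases Int.units_eq_one_or (η i) with h2 | h2 <;>
      simp_all [signVal]

variable [DecidableEq κ]

lemma card_signs : Fintype.card (κ → ℤˣ) = 2 ^ Fintype.card κ := by
  simp

lemma expect_prod_one_add_mul_signVal (t : κ → ℝ) :
    𝔼 η : κ → ℤˣ, ∏ i, (1 + t i * signVal (η i)) = 1 := by
  rw [Fintype.expect_eq_sum_div_card, card_signs]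
  have h := Finset.prod_univ_sum (fun _ : κ => (Finset.univ : Finset ℤˣ))
    (fun i u => 1 + t i * signVal u)
  rw [Fintype.piFinset_univ] at h
  rw [← h]
  have h2 : ∀ i : κ, ∑ u : ℤˣ, (1 + t i * signVal u) = 2 := by
    intro i
    rw [UnitsInt.univ, Finset.sum_pair (by decide), signVal_one, signVal_neg_one]
    ring
  rw [Finset.prod_congr rfl fun i _ => h2 i]
  simp

lemma sum_sq_expect_walsh (a : (κ → ℤˣ) → ℝ) :
    ∑ S : Finset κ, (𝔼 ε, walsh S ε * a ε) ^ 2 = 𝔼 ε, a ε ^ 2 := by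
  have h1 : ∀ S : Finset κ, (𝔼 ε, walsh S ε * a ε) ^ 2
      = 𝔼 ε, 𝔼 η, walsh S ε * walsh S η * (a ε * a η) := by
    intro S
    rw [sq, Finset.expect_mul_expect]
    refine Finset.expect_congr rfl fun ε _ => Finset.expect_congr rfl fun η _ => ?_
    ring
  simp only [h1]
  rw [← Finset.expect_sum_comm]
  refine Finset.expect_congr rfl fun ε _ => ?_
  rw [← Finset.expect_sum_comm]
  have h2 : ∀ η : κ → ℤˣ, ∑ S : Finset κ, walsh S ε * walsh S η * (a ε * a η)
      = if ε = η then 2 ^ Fintype.card κ * (a ε * a η) else 0 := by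
    intro η
    have := prod_one_add_signVal ε η
    rw [Finset.prod_one_add, Finset.powerset_univ] at this
    simp only [Finset.prod_mul_distrib] at this
    rw [← Finset.sum_mul]
    simp only [walsh]
    rw [this]
    split_ifs <;> simp
  simp only [h2]
  rw [Fintype.expect_eq_sum_div_card, card_signs, Finset.sum_ite_eq]
  simp
  field_simp

lemma abs_sum_expect_walsh_mul_le (j : ℕ) (a b : (κ → ℤˣ) → ℝ) :
    |∑ S ∈ Finset.powersetCard j Finset.univ,
        (𝔼 ε, walsh S ε * a ε) * (𝔼 η, walsh S η * b η)|
      ≤ (𝔼 ε, a ε ^ 2 + 𝔼 ε, b ε ^ 2) / 2 := by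
  rw [← sum_sq_expect_walsh a, ← sum_sq_expect_walsh b, ← Finset.sum_add_distrib, Finset.sum_div]
  refine (Finset.abs_sum_le_sum_abs _ _).trans ?_
  refine (Finset.sum_le_sum (g := fun S => ((𝔼 ε, walsh S ε * a ε) ^ 2
    + (𝔼 ε, walsh S ε * b ε) ^ 2) / 2) fun S _ => ?_).trans
    (Finset.sum_le_sum_of_subset_of_nonneg (Finset.subset_univ _) fun S _ _ => by positivity)
  rw [abs_mul]
  nlinarith [sq_nonneg (|𝔼 ε, walsh S ε * a ε| - |𝔼 ε, walsh S ε * b ε|),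
    sq_abs (𝔼 ε, walsh S ε * a ε), sq_abs (𝔼 ε, walsh S ε * b ε)]

/-- Scalar form of the logarithmic bound for the Rademacher projection. -/
lemma abs_expect_rademacher_le {ι : Type*} [Fintype ι] (A : (κ → ℤˣ) → (κ → ℤˣ) → ℝ)
    (a b : ι → (κ → ℤˣ) → ℝ) (r : (κ → ℤˣ) → ℝ) (D : ℝ) {d : ℕ} (hd : 1 ≤ d)
    (hA : ∀ ε η, A ε η = ∑ l, a l ε * b l η) (hAr : ∀ ε η, |A ε η| ≤ r ε)
    (hr : 𝔼 ε, r ε ^ 2 ≤ 1) (ha : ∀ l, 𝔼 ε, a l ε ^ 2 ≤ 1) (hb : ∀ l, 𝔼 ε, b l ε ^ 2 ≤ D)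
    (hD : Fintype.card ι * ((1 + D) / 2) ≤ 2 ^ d) :
    |𝔼 ε : κ → ℤˣ, 𝔼 η : κ → ℤˣ, (∑ i, signVal (ε i) * signVal (η i)) * A ε η| ≤ 40 * d := by
  rcases isEmpty_or_nonempty κ with hκ | hκ
  · simp
  set c : ℕ → ℝ := fun j => 𝔼 ε : κ → ℤˣ, 𝔼 η : κ → ℤˣ,
    (∑ S ∈ Finset.powersetCard j Finset.univ, walsh S ε * walsh S η) * A ε η with hc
  have hc1 : c 1 = 𝔼 ε : κ → ℤˣ, 𝔼 η : κ → ℤˣ, (∑ i, signVal (ε i) * signVal (η i)) * A ε η := by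
    simp only [hc]
    refine Finset.expect_congr rfl fun ε _ => Finset.expect_congr rfl fun η _ => ?_
    rw [Finset.powersetCard_one, Finset.sum_map]
    simp [walsh]
  rw [← hc1]
  refine abs_linear_coeff_le_of_coeff_le hd (k := Fintype.card κ) Fintype.card_pos ?_ ?_
  · intro ρ hρ
    have h1 : ∑ j ∈ Finset.range (Fintype.card κ + 1), c j * ρ ^ j
        = 𝔼 ε : κ → ℤˣ, 𝔼 η : κ → ℤˣ, (∏ i, (1 + ρ * (signVal (ε i) * signVal (η i)))) * A ε η := by
      simp only [prod_one_add_eq_sum_walsh, hc, Finset.expect_mul, Finset.sum_mul]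
      rw [← Finset.expect_sum_comm]
      refine Finset.expect_congr rfl fun ε _ => ?_
      rw [← Finset.expect_sum_comm]
      refine Finset.expect_congr rfl fun η _ => ?_
      refine Finset.sum_congr rfl fun j _ => ?_
      refine Finset.sum_congr rfl fun S _ => ?_
      ring
    rw [h1]
    have hpos : ∀ ε η : κ → ℤˣ, 0 ≤ ∏ i, (1 + ρ * (signVal (ε i) * signVal (η i))) := by
      intro ε η
      refine Finset.prod_nonneg fun i _ => ?_
      have h2 : |ρ * (signVal (ε i) * signVal (η i))| ≤ 1 := by
        rw [abs_mul, abs_mul, abs_signVal, abs_signVal]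
        simpa using abs_le.mpr hρ
      linarith [(abs_le.mp h2).1]
    calc _ ≤ 𝔼 ε : κ → ℤˣ, |𝔼 η : κ → ℤˣ, (∏ i, (1 + ρ * (signVal (ε i) * signVal (η i)))) * A ε η| :=
          Finset.abs_expect_le _ _
      _ ≤ 𝔼 ε, r ε := by
          refine Finset.expect_le_expect fun ε _ => ?_
          calc _ ≤ 𝔼 η : κ → ℤˣ, |(∏ i, (1 + ρ * (signVal (ε i) * signVal (η i)))) * A ε η| :=
                Finset.abs_expect_le _ _
            _ ≤ 𝔼 η : κ → ℤˣ, (∏ i, (1 + ρ * (signVal (ε i) * signVal (η i)))) * r ε := by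
                refine Finset.expect_le_expect fun η _ => ?_
                rw [abs_mul, abs_of_nonneg (hpos ε η)]
                exact mul_le_mul_of_nonneg_left (hAr ε η) (hpos ε η)
            _ = r ε := by
                rw [← Finset.expect_mul]
                have := expect_prod_one_add_mul_signVal fun i => ρ * signVal (ε i)
                simp only [mul_assoc] at this
                rw [this, one_mul]
      _ ≤ 𝔼 ε, (1 + r ε ^ 2) / 2 := by
          refine Finset.expect_le_expect fun ε _ => ?_
          nlinarith [sq_nonneg (r ε - 1)]
      _ = (1 + 𝔼 ε, r ε ^ 2) / 2 := by
          rw [← Finset.expect_div, Finset.expect_add_distrib, Fintype.expect_const]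
      _ ≤ 1 := by linarith
  · intro j
    have h1 : c j = ∑ l, ∑ S ∈ Finset.powersetCard j Finset.univ,
        (𝔼 ε, walsh S ε * a l ε) * (𝔼 η, walsh S η * b l η) := by
      simp only [hc, hA, Finset.expect_mul_expect]
      simp only [← Finset.expect_sum_comm]
      refine Finset.expect_congr rfl fun ε _ => Finset.expect_congr rfl fun η _ => ?_
      rw [Finset.sum_mul_sum, Finset.sum_comm]
      refine Finset.sum_congr rfl fun l _ => Finset.sum_congr rfl fun S _ => ?_
      ring
    rw [h1]
    refine (Finset.abs_sum_le_sum_abs _ _).trans (le_trans ?_ hD)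
    rw [← nsmul_eq_mul, ← Finset.card_univ]
    refine Finset.sum_le_card_nsmul _ _ _ fun l _ => ?_
    refine (abs_sum_expect_walsh_mul_le j (a l) (b l)).trans ?_
    linarith [ha l, hb l]

end Walsh
/-! ### Norms given as functions, and the vector-valued Rademacher projection -/

/-- The function `N` is a norm on the real vector space `E`. -/
structure IsNormFn {E : Type*} [AddCommGroup E] [Module ℝ E] (N : E → ℝ) : Prop where
  add_le : ∀ x y, N (x + y) ≤ N x + N y
  smul : ∀ (t : ℝ) (x), N (t • x) = |t| * N x
  eq_zero : ∀ x, N x = 0 → x = 0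

namespace IsNormFn

variable {E : Type*} [AddCommGroup E] [Module ℝ E] {N : E → ℝ}

lemma map_zero (hN : IsNormFn N) : N 0 = 0 := by
  simpa using hN.smul 0 0

lemma map_neg (hN : IsNormFn N) (x : E) : N (-x) = N x := by
  simpa using hN.smul (-1) x

lemma nonneg (hN : IsNormFn N) (x : E) : 0 ≤ N x := by
  have := hN.add_le x (-x)
  rw [add_neg_cancel, hN.map_zero, hN.map_neg] at this
  linarith

lemma abs_apply_le (hN : IsNormFn N) {f : E →ₗ[ℝ] ℝ} (hf : ∀ y, f y ≤ N y) (y : E) :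
    |f y| ≤ N y := by
  refine abs_le.mpr ⟨?_, hf y⟩
  have := hf (-y)
  rw [hN.map_neg, _root_.map_neg] at this
  linarith

/-- Every vector has a norming functional. -/
lemma exists_functional (hN : IsNormFn N) (x : E) :
    ∃ f : E →ₗ[ℝ] ℝ, f x = N x ∧ ∀ y, |f y| ≤ N y := by
  by_cases hx : x = 0
  · exact ⟨0, by simp [hx, hN.map_zero], fun y => by simpa using hN.nonneg y⟩
  obtain ⟨g, hg, hgN⟩ := exists_extension_of_le_sublinear
    (LinearPMap.mkSpanSingleton (K := ℝ) (L := ℝ) (σ := RingHom.id ℝ) x (N x) hx) N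
    (fun c hc y => by rw [hN.smul, abs_of_pos hc]) hN.add_le (by
      rintro ⟨y, hy⟩
      obtain ⟨c, rfl⟩ := Submodule.mem_span_singleton.mp hy
      rw [LinearPMap.mkSpanSingleton'_apply, hN.smul, smul_eq_mul, RingHom.id_apply]
      exact mul_le_mul_of_nonneg_right (le_abs_self c) (hN.nonneg x))
  refine ⟨g, ?_, hN.abs_apply_le hgN⟩
  have h1 := hg ⟨x, Submodule.mem_span_singleton_self x⟩
  rw [h1]
  exact LinearPMap.mkSpanSingleton_apply ℝ ℝ hx (N x)

end IsNormFn

section SignVectors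

variable {κ : Type*} [Fintype κ] [DecidableEq κ]

lemma expect_signVal_mul_signVal (i j : κ) :
    𝔼 ε : κ → ℤˣ, signVal (ε i) * signVal (ε j) = if i = j then 1 else 0 := by
  split_ifs with h
  · subst h
    simp only [signVal_mul_self]
    exact Fintype.expect_const _
  · have h1 : 𝔼 ε : κ → ℤˣ, signVal (ε i) * signVal (ε j)
        = 𝔼 ε : κ → ℤˣ, -(signVal (ε i) * signVal (ε j)) := by
      refine Fintype.expect_equiv (Equiv.mulLeft (Pi.mulSingle i (-1))) _ _ fun ε => ?_
      simp [signVal, Pi.mulSingle_eq_of_ne (Ne.symm h)]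
    rw [Finset.expect_neg_distrib] at h1
    linarith

lemma expect_sq_sum_signVal_mul (t : κ → ℝ) :
    𝔼 ε : κ → ℤˣ, (∑ i, signVal (ε i) * t i) ^ 2 = ∑ i, t i ^ 2 := by
  have h1 : ∀ ε : κ → ℤˣ, (∑ i, signVal (ε i) * t i) ^ 2
      = ∑ i, ∑ j, (signVal (ε i) * signVal (ε j)) * (t i * t j) := by
    intro ε
    rw [sq, Finset.sum_mul_sum]
    exact Finset.sum_congr rfl fun i _ => Finset.sum_congr rfl fun j _ => by ring
  simp only [h1, Finset.expect_sum_comm, ← Finset.expect_mul, expect_signVal_mul_signVal]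
  simp [sq]

variable {n : ℕ} {N : EuclideanSpace ℝ (Fin n) → ℝ}

/-- The Rademacher projection of a bounded function on the sign cube, with values in a norm
polynomially close to the euclidean one, has second moment at most logarithmic in `n`. -/
lemma expect_sq_rademacher_le (hN : IsNormFn N) (h1 : ∀ x, N x ≤ ‖x‖)
    (h2 : ∀ x, ‖x‖ ≤ n * N x) {d : ℕ} (hd : 1 ≤ d) (hnd : (n : ℝ) * ((1 + n ^ 2) / 2) ≤ 2 ^ d)
    (f : (κ → ℤˣ) → EuclideanSpace ℝ (Fin n)) (hf : ∀ ε, N (f ε) ≤ 1)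
    (x : κ → EuclideanSpace ℝ (Fin n))
    (hx : ∀ (g : EuclideanSpace ℝ (Fin n) →ₗ[ℝ] ℝ) (i : κ),
      g (x i) = 𝔼 ε, signVal (ε i) * g (f ε)) :
    𝔼 ε : κ → ℤˣ, N (∑ i, signVal (ε i) • x i) ^ 2 ≤ (40 * d) ^ 2 := by
  set R : (κ → ℤˣ) → EuclideanSpace ℝ (Fin n) := fun ε => ∑ i, signVal (ε i) • x i with hR
  choose g hg hgN using fun ε => hN.exists_functional (R ε)
  set V : ℝ := 𝔼 ε : κ → ℤˣ, N (R ε) ^ 2 with hV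
  have hV0 : 0 ≤ V := Finset.expect_nonneg fun ε _ => by positivity
  rcases hV0.eq_or_lt with hV0 | hV0
  · change V ≤ _
    rw [← hV0]; positivity
  set M : ℝ := Real.sqrt V with hM
  have hM0 : 0 < M := Real.sqrt_pos.mpr hV0
  have hMV : M ^ 2 = V := Real.sq_sqrt hV0.le
  have hr : 𝔼 ε : κ → ℤˣ, (N (R ε) / M) ^ 2 = 1 := by
    simp only [div_pow]
    rw [← Finset.expect_div, hMV]
    exact div_self hV0.ne'
  have hsingle : ∀ ε (l : Fin n), |g ε (EuclideanSpace.single l 1)| ≤ 1 := fun ε l =>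
    (hgN ε _).trans ((h1 _).trans (by simp))
  have key := abs_expect_rademacher_le (fun ε η => N (R ε) / M * g ε (f η))
    (fun (l : Fin n) ε => N (R ε) / M * g ε (EuclideanSpace.single l 1)) (fun l η => f η l)
    (fun ε => N (R ε) / M) ((n : ℝ) ^ 2) hd ?_ ?_ hr.le ?_ ?_ (by simpa using hnd)
  · have h3 : 𝔼 ε : κ → ℤˣ, 𝔼 η : κ → ℤˣ,
        (∑ i, signVal (ε i) * signVal (η i)) * (N (R ε) / M * g ε (f η)) = M := by
      calc _ = 𝔼 ε : κ → ℤˣ, N (R ε) ^ 2 / M := by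
            refine Finset.expect_congr rfl fun ε _ => ?_
            have h4 : N (R ε) = ∑ i, signVal (ε i) * 𝔼 η, signVal (η i) * g ε (f η) := by
              rw [← hg ε]
              simp only [hR, map_sum, map_smul, hx, smul_eq_mul]
            have h5 : N (R ε) ^ 2 / M = (N (R ε) / M) * N (R ε) := by ring
            rw [h5]
            nth_rewrite 3 [h4]
            simp only [Finset.mul_expect, Finset.mul_sum]
            rw [← Finset.expect_sum_comm]
            refine Finset.expect_congr rfl fun η _ => ?_
            rw [Finset.sum_mul]
            exact Finset.sum_congr rfl fun i _ => by ring
        _ = M := by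
            rw [← Finset.expect_div, div_eq_iff hM0.ne', ← sq, hMV]
    rw [h3, abs_of_pos hM0] at key
    change V ≤ _
    rw [← hMV]
    gcongr
  · intro ε η
    have h6 : f η = ∑ l, (f η l) • EuclideanSpace.single l (1 : ℝ) := by
      ext m
      simp [Pi.single_apply]
    conv_lhs => rw [h6]
    rw [map_sum, Finset.mul_sum]
    refine Finset.sum_congr rfl fun l _ => ?_
    rw [map_smul, smul_eq_mul]; ring
  · intro ε η
    have h7 : 0 ≤ N (R ε) / M := div_nonneg (hN.nonneg _) hM0.le
    rw [abs_mul, abs_of_nonneg h7]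
    exact mul_le_of_le_one_right h7 ((hgN ε _).trans (hf η))
  · intro l
    refine le_trans ?_ hr.le
    refine Finset.expect_le_expect fun ε _ => ?_
    rw [mul_pow]
    refine mul_le_of_le_one_right (by positivity) ?_
    rw [← sq_abs]
    exact pow_le_one₀ (abs_nonneg _) (hsingle ε l)
  · intro l
    refine (Finset.expect_le_expect (g := fun _ => (n : ℝ) ^ 2) fun ε _ => ?_).trans
      (Fintype.expect_const _).le
    rw [← sq_abs]
    have h8 : |f ε l| ≤ n := by
      calc |f ε l| ≤ ‖f ε‖ := by
            rw [← Real.norm_eq_abs]; exact PiLp.norm_apply_le (f ε) l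
        _ ≤ n * N (f ε) := h2 _
        _ ≤ n * 1 := by gcongr; exact hf ε
        _ = n := mul_one _
    gcongr

end SignVectors
/-! ### Selecting coordinates with a uniform bound over all signs -/

section Selection

variable {τ : Type*} [Fintype τ] [Nonempty τ]

/-- The maximum of a function on a nonempty finite type. -/
noncomputable def maxVal (F : τ → ℝ) : ℝ := Finset.univ.sup' Finset.univ_nonempty F

lemma le_maxVal (F : τ → ℝ) (t : τ) : F t ≤ maxVal F := Finset.le_sup' F (Finset.mem_univ t)

lemma maxVal_le {F : τ → ℝ} {b : ℝ} (h : ∀ t, F t ≤ b) : maxVal F ≤ b :=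
  Finset.sup'_le _ _ fun t _ => h t

lemma exists_eq_maxVal (F : τ → ℝ) : ∃ t, maxVal F = F t := by
  obtain ⟨t, -, ht⟩ := Finset.exists_mem_eq_sup' Finset.univ_nonempty F
  exact ⟨t, ht⟩

lemma maxVal_step (B v : τ → ℝ) {δ : ℝ} (h0 : 0 ≤ δ) (h1 : δ ≤ 1) :
    δ * maxVal (fun t => B t + |v t|) + (1 - δ) * maxVal B
      ≤ (maxVal (fun t => B t + (δ * |v t| + v t)) + maxVal (fun t => B t + (δ * |v t| - v t))) / 2 := by
  obtain ⟨t, ht⟩ := exists_eq_maxVal fun t => B t + |v t|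
  obtain ⟨s, hs⟩ := exists_eq_maxVal B
  have h2 := le_maxVal (fun t => B t + |v t|) s
  have h3 := le_maxVal B t
  have h4 := le_maxVal (fun t => B t + (δ * |v t| + v t))
  have h5 := le_maxVal (fun t => B t + (δ * |v t| - v t))
  rw [ht] at h2 ⊢
  rw [hs] at h3 ⊢
  have h6 : (B t + B s + (1 + δ) * |v t| - (1 - δ) * |v s|) / 2
      ≤ (maxVal (fun t => B t + (δ * |v t| + v t))
        + maxVal (fun t => B t + (δ * |v t| - v t))) / 2 := by
    rcases le_total 0 (v t) with h | h
    · linarith [h4 t, h5 s, abs_of_nonneg h, le_abs_self (v s)]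
    · linarith [h5 t, h4 s, abs_of_nonpos h, neg_abs_le (v s)]
  refine le_trans ?_ h6
  nlinarith [mul_nonneg h0 (sub_nonneg.mpr h3),
    mul_nonneg (sub_nonneg.mpr h1) (sub_nonneg.mpr h2)]

variable {κ : Type*} [Fintype κ] [DecidableEq κ]

lemma expect_signs_flip (i : κ) (F : (κ → ℤˣ) → ℝ) :
    𝔼 ε, F ε = 𝔼 ε : κ → ℤˣ, (F ε + F (Pi.mulSingle i (-1) * ε)) / 2 := by
  have h : 𝔼 ε : κ → ℤˣ, F (Pi.mulSingle i (-1) * ε) = 𝔼 ε, F ε :=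
    Fintype.expect_equiv (Equiv.mulLeft (Pi.mulSingle i (-1))) _ _ fun ε => rfl
  rw [← Finset.expect_div, Finset.expect_add_distrib, h]
  ring

lemma exists_selection (t : κ → τ → ℝ) {δ : ℝ} (h0 : 0 ≤ δ) (h1 : δ ≤ 1) (I : Finset κ) :
    ∀ (B : τ → ℝ) (β : ℝ), ∃ σ ⊆ I,
      maxVal (fun s => B s + ∑ i ∈ σ, |t i s|) + β * (1 / 2) ^ σ.card
        ≤ 𝔼 ε : κ → ℤˣ, maxVal (fun s => B s + ∑ i ∈ I, (δ * |t i s| + signVal (ε i) * t i s))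
          + β * (1 - δ / 2) ^ I.card := by
  induction I using Finset.induction_on with
  | empty =>
    intro B β
    refine ⟨∅, subset_rfl, ?_⟩
    simp
  | insert i I hi ih =>
    intro B β
    obtain ⟨σ₁, hσ₁, e₁⟩ := ih (fun s => B s + |t i s|) (β / 2)
    obtain ⟨σ₂, hσ₂, e₂⟩ := ih B β
    have hi₁ : i ∉ σ₁ := fun h => hi (hσ₁ h)
    set G : (κ → ℤˣ) → τ → ℝ := fun ε s => ∑ j ∈ I, (δ * |t j s| + signVal (ε j) * t j s) with hG
    have hstep : δ * 𝔼 ε : κ → ℤˣ, maxVal (fun s => B s + |t i s| + G ε s)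
        + (1 - δ) * 𝔼 ε : κ → ℤˣ, maxVal (fun s => B s + G ε s)
        ≤ 𝔼 ε : κ → ℤˣ, maxVal (fun s => B s
          + ∑ j ∈ insert i I, (δ * |t j s| + signVal (ε j) * t j s)) := by
      rw [expect_signs_flip i (fun ε : κ → ℤˣ => maxVal (fun s => B s
          + ∑ j ∈ insert i I, (δ * |t j s| + signVal (ε j) * t j s))),
        Finset.mul_expect, Finset.mul_expect, ← Finset.expect_add_distrib]
      refine Finset.expect_le_expect fun ε _ => ?_
      have h2 := maxVal_step (fun s => B s + G ε s) (t i) h0 h1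
      have h3 : (fun s => B s + |t i s| + G ε s) = fun s => B s + G ε s + |t i s| := by
        funext s; ring
      have h4 : ∀ s, ∑ j ∈ I, (δ * |t j s| + signVal ((Pi.mulSingle i (-1) * ε : κ → ℤˣ) j) * t j s)
          = G ε s := by
        intro s
        refine Finset.sum_congr rfl fun j hj => ?_
        have : j ≠ i := fun h => hi (h ▸ hj)
        simp [Pi.mulSingle_eq_of_ne this]
      simp only [Finset.sum_insert hi, h4]
      rw [h3]
      refine h2.trans (le_of_eq ?_)
      rcases Int.units_eq_one_or (ε i) with h5 | h5
      · simp only [Pi.mul_apply, Pi.mulSingle_eq_same, h5, mul_one, signVal_one, signVal_neg_one]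
        congr 2
        · exact congrArg maxVal (funext fun s => by simp only [hG]; ring)
        · exact congrArg maxVal (funext fun s => by simp only [hG]; ring)
      · simp only [Pi.mul_apply, Pi.mulSingle_eq_same, h5, neg_mul_neg, mul_one, signVal_one,
          signVal_neg_one]
        rw [add_comm]
        congr 2
        · exact congrArg maxVal (funext fun s => by simp only [hG]; ring)
        · exact congrArg maxVal (funext fun s => by simp only [hG]; ring)
    rw [Finset.card_insert_of_notMem hi, pow_succ]
    have c₁ := mul_le_mul_of_nonneg_left e₁ h0
    have c₂ := mul_le_mul_of_nonneg_left e₂ (sub_nonneg.mpr h1)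
    set W := 𝔼 ε : κ → ℤˣ, maxVal (fun s => B s
      + ∑ j ∈ insert i I, (δ * |t j s| + signVal (ε j) * t j s)) with hW
    set X₁ := maxVal (fun s => B s + |t i s| + ∑ j ∈ σ₁, |t j s|) + β / 2 * (1 / 2) ^ σ₁.card with hX₁
    set X₂ := maxVal (fun s => B s + ∑ j ∈ σ₂, |t j s|) + β * (1 / 2) ^ σ₂.card with hX₂
    have key : δ * X₁ + (1 - δ) * X₂ ≤ W + β * ((1 - δ / 2) ^ I.card * (1 - δ / 2)) := by
      linarith
    rcases le_total X₁ X₂ with h | h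
    · refine ⟨insert i σ₁, Finset.insert_subset_insert i hσ₁, ?_⟩
      have h6 : maxVal (fun s => B s + ∑ j ∈ insert i σ₁, |t j s|)
          + β * (1 / 2) ^ (insert i σ₁).card = X₁ := by
        rw [Finset.card_insert_of_notMem hi₁, hX₁, pow_succ]
        congr 1
        · exact congrArg maxVal (funext fun s => by rw [Finset.sum_insert hi₁]; ring)
        · ring
      rw [h6]
      nlinarith [mul_nonneg (sub_nonneg.mpr h1) (sub_nonneg.mpr h)]
    · refine ⟨σ₂, hσ₂.trans (Finset.subset_insert i I), ?_⟩
      nlinarith [mul_nonneg h0 (sub_nonneg.mpr h)]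

/-- If the Rademacher sum of `x` has second moment at most `M ^ 2`, then all signed sums over a
suitable subfamily of size proportional to `√k` are at most a multiple of `M`. -/
lemma exists_subset_signed_sums_le {E : Type*} [AddCommGroup E] [Module ℝ E] {N : E → ℝ}
    (hN : IsNormFn N) (hκ : 0 < Fintype.card κ) (x : κ → E) {M : ℝ} (hM : 0 < M)
    (h : 𝔼 ε : κ → ℤˣ, N (∑ i, signVal (ε i) • x i) ^ 2 ≤ M ^ 2) :
    ∃ σ : Finset κ, Real.sqrt (Fintype.card κ) / 10 ≤ σ.card ∧
      ∀ ε : κ → ℤˣ, N (∑ i ∈ σ, signVal (ε i) • x i) ≤ 12 * M := by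
  set k := Fintype.card κ with hk
  set r := Real.sqrt k with hr
  have hk1 : (1 : ℝ) ≤ k := by exact_mod_cast hκ
  have hr1 : 1 ≤ r := Real.one_le_sqrt.mpr hk1
  have hr2 : r ^ 2 = k := Real.sq_sqrt (by positivity)
  choose g hg hgN using fun s : Finset κ × (κ → ℤˣ) =>
    hN.exists_functional (∑ i ∈ s.1, signVal (s.2 i) • x i)
  have hsq : ∀ s, ∑ i, g s (x i) ^ 2 ≤ M ^ 2 := by
    intro s
    rw [← expect_sq_sum_signVal_mul]
    refine le_trans (Finset.expect_le_expect fun ε _ => ?_) h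
    have h2 : ∑ i, signVal (ε i) * g s (x i) = g s (∑ i, signVal (ε i) • x i) := by
      simp [map_sum]
    rw [h2, ← sq_abs]
    gcongr
    exact hgN s _
  have habs : ∀ s, ∑ i, |g s (x i)| ≤ r * M := by
    intro s
    refine abs_le_of_sq_le_sq' ?_ (by positivity) |>.2
    calc (∑ i, |g s (x i)|) ^ 2 ≤ k * ∑ i, |g s (x i)| ^ 2 := by
          simpa [hk] using sq_sum_le_card_mul_sum_sq (s := Finset.univ) (f := fun i => |g s (x i)|)
      _ ≤ k * M ^ 2 := by
          simp only [sq_abs]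
          gcongr
          exact hsq s
      _ = (r * M) ^ 2 := by rw [mul_pow, hr2]
  have hmean : 𝔼 ε : κ → ℤˣ, N (∑ i, signVal (ε i) • x i) ≤ M := by
    calc _ ≤ 𝔼 ε : κ → ℤˣ, (N (∑ i, signVal (ε i) • x i) ^ 2 + M ^ 2) / (2 * M) := by
          refine Finset.expect_le_expect fun ε _ => ?_
          rw [le_div_iff₀ (by positivity)]
          nlinarith [sq_nonneg (N (∑ i, signVal (ε i) • x i) - M)]
      _ = (𝔼 ε : κ → ℤˣ, N (∑ i, signVal (ε i) • x i) ^ 2 + M ^ 2) / (2 * M) := by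
          rw [← Finset.expect_div, Finset.expect_add_distrib, Fintype.expect_const]
      _ ≤ M := by
          rw [div_le_iff₀ (by positivity)]
          nlinarith
  set δ : ℝ := 1 / (2 * r) with hδ
  have hδ0 : 0 < δ := by positivity
  have hδ1 : δ ≤ 1 / 2 := by
    rw [hδ]; gcongr; linarith
  set w : ℝ := (1 - δ / 2) ^ k with hw
  have hw0 : 0 < w := pow_pos (by linarith) _
  have hwexp : w ≤ Real.exp (-(r / 4)) := by
    calc w ≤ Real.exp (-(δ / 2)) ^ k := by
          refine pow_le_pow_left₀ (by linarith) ?_ k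
          linarith [Real.add_one_le_exp (-(δ / 2))]
      _ = Real.exp (-(r / 4)) := by
          rw [← Real.exp_nat_mul, ← hr2, hδ]
          congr 1
          field_simp
          ring
  obtain ⟨σ, -, hσ⟩ := exists_selection (fun i s => g s (x i)) hδ0.le (by linarith)
    Finset.univ (fun _ => 0) (7 * (3 / 2 * M) / w)
  have hupper : 𝔼 ε : κ → ℤˣ, maxVal (fun s => (0 : ℝ)
      + ∑ i, (δ * |g s (x i)| + signVal (ε i) * g s (x i))) ≤ 3 / 2 * M := by
    calc _ ≤ 𝔼 ε : κ → ℤˣ, (M / 2 + N (∑ i, signVal (ε i) • x i)) := by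
          refine Finset.expect_le_expect fun ε _ => maxVal_le fun s => ?_
          rw [zero_add, Finset.sum_add_distrib, ← Finset.mul_sum]
          have h2 : ∑ i, signVal (ε i) * g s (x i) = g s (∑ i, signVal (ε i) • x i) := by
            simp [map_sum]
          rw [h2]
          refine add_le_add ?_ ((le_abs_self _).trans (hgN s _))
          calc δ * ∑ i, |g s (x i)| ≤ δ * (r * M) := by gcongr; exact habs s
            _ = M / 2 := by rw [hδ]; field_simp
      _ ≤ 3 / 2 * M := by
          rw [Finset.expect_add_distrib, Fintype.expect_const]
          linarith
  have h8 : 7 * (3 / 2 * M) / w * (1 - δ / 2) ^ (Finset.univ : Finset κ).card = 7 * (3 / 2 * M) := by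
    rw [Finset.card_univ, ← hk, ← hw]
    field_simp
  rw [h8] at hσ
  have hlow : ∀ ε : κ → ℤˣ, N (∑ i ∈ σ, signVal (ε i) • x i)
      ≤ maxVal (fun s => (0 : ℝ) + ∑ i ∈ σ, |g s (x i)|) := by
    intro ε
    refine le_trans ?_ (le_maxVal _ (σ, ε))
    rw [← hg (σ, ε), zero_add, map_sum]
    refine Finset.sum_le_sum fun i _ => ?_
    rw [map_smul, smul_eq_mul]
    refine (le_abs_self _).trans ?_
    rw [abs_mul, abs_signVal, one_mul]
  have hpow : 0 ≤ 7 * (3 / 2 * M) / w * (1 / 2) ^ σ.card := by positivity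
  refine ⟨σ, ?_, fun ε => by linarith [hlow ε]⟩
  have h9 : 7 * (3 / 2 * M) / w * (1 / 2) ^ σ.card ≤ 8 * (3 / 2 * M) := by
    linarith [hlow 1, hN.nonneg (∑ i ∈ σ, signVal ((1 : κ → ℤˣ) i) • x i)]
  have h10 : (1 / 2 : ℝ) ^ σ.card ≤ 8 / 7 * w := by
    rw [div_mul_eq_mul_div, div_le_iff₀ hw0] at h9
    nlinarith
  have h11 : (8 / 7 : ℝ) ≤ Real.exp (1 / 7) := by
    linarith [Real.add_one_le_exp (1 / 7 : ℝ)]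
  have h12 : Real.exp (-(σ.card : ℝ)) ≤ Real.exp (1 / 7 - r / 4) := by
    calc Real.exp (-(σ.card : ℝ)) = Real.exp (-1) ^ σ.card := by
          rw [← Real.exp_nat_mul]; congr 1; ring
      _ ≤ (1 / 2) ^ σ.card := by
          refine pow_le_pow_left₀ (Real.exp_pos _).le ?_ _
          rw [Real.exp_neg, one_div]
          refine inv_anti₀ (by norm_num) ?_
          linarith [Real.add_one_le_exp (1 : ℝ)]
      _ ≤ 8 / 7 * w := h10
      _ ≤ Real.exp (1 / 7) * Real.exp (-(r / 4)) := by gcongr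
      _ = _ := by rw [← Real.exp_add]; congr 1
  have h13 := Real.exp_le_exp.mp h12
  linarith

end Selection
/-! ### A Sauer–Shelah lemma for finite sets of integer vectors -/

section Shatter

variable {ι : Type*} [Fintype ι] [DecidableEq ι]

lemma card_le_card_image_update_add (A : Finset (ι → ℤ)) (V : Finset ℤ) (i : ι)
    (hV : ∀ y ∈ A, y i ∈ V) :
    A.card ≤ (A.image fun y => Function.update y i 0).card
      + ∑ v ∈ V ×ˢ V, ((A.image fun y => Function.update y i 0).filter fun z =>
          v.1 < v.2 ∧ Function.update z i v.1 ∈ A ∧ Function.update z i v.2 ∈ A).card := by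
  set A' := A.image fun y => Function.update y i 0 with hA'
  have hswap := Finset.sum_card_bipartiteAbove_eq_sum_card_bipartiteBelow (s := V ×ˢ V) (t := A')
    (fun (v : ℤ × ℤ) z => v.1 < v.2 ∧ Function.update z i v.1 ∈ A ∧ Function.update z i v.2 ∈ A)
  simp only [Finset.bipartiteAbove, Finset.bipartiteBelow] at hswap
  rw [hswap, Finset.card_eq_sum_card_image (fun y => Function.update y i 0) A, ← hA',
    Finset.card_eq_sum_ones, ← Finset.sum_add_distrib]
  refine Finset.sum_le_sum fun z hz => ?_
  set F := A.filter fun y => Function.update y i 0 = z with hF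
  have hFne : F.Nonempty := by
    obtain ⟨y, hy, hyz⟩ := Finset.mem_image.mp hz
    exact ⟨y, Finset.mem_filter.mpr ⟨hy, hyz⟩⟩
  obtain ⟨y₀, hy₀, hmin⟩ := Finset.exists_min_image F (fun y => y i) hFne
  have hrec : ∀ y ∈ F, Function.update z i (y i) = y := by
    intro y hy
    rw [← (Finset.mem_filter.mp hy).2, Function.update_idem, Function.update_eq_self]
  rw [← Finset.card_erase_add_one hy₀, add_comm]
  refine Nat.add_le_add_left ?_ 1
  refine Finset.card_le_card_of_injOn (fun y => (y₀ i, y i)) ?_ ?_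
  · intro y hy
    obtain ⟨hne, hyF⟩ := Finset.mem_erase.mp hy
    have hyA := (Finset.mem_filter.mp hyF).1
    have hy₀A := (Finset.mem_filter.mp hy₀).1
    refine Finset.mem_coe.mpr (Finset.mem_filter.mpr
      ⟨Finset.mem_product.mpr ⟨hV _ hy₀A, hV _ hyA⟩, ?_, ?_, ?_⟩)
    · refine lt_of_le_of_ne (hmin y hyF) fun h => hne ?_
      rw [← hrec y hyF, ← hrec y₀ hy₀]
      exact congrArg _ h.symm
    · simpa only [hrec y₀ hy₀] using hy₀A
    · simpa only [hrec y hyF] using hyA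
  · intro y hy y' hy' h
    have h1 : y i = y' i := (Prod.mk.inj h).2
    rw [← hrec y (Finset.mem_of_mem_erase hy), ← hrec y' (Finset.mem_of_mem_erase hy'), h1]

lemma exists_shattered (V : Finset ℤ) {R : ℕ} (hR : V.card ≤ R) (I : Finset ι) :
    ∀ A : Finset (ι → ℤ), A.Nonempty → (∀ y ∈ A, ∀ i ∈ I, y i ∈ V) → (∀ y ∈ A, ∀ i ∉ I, y i = 0) →
      ∃ σ ⊆ I, ∃ p q : ι → ℤ, (∀ i ∈ σ, p i < q i) ∧
        (∀ e : ι → ℤˣ, ∃ y ∈ A, ∀ i ∈ σ, y i = if e i = 1 then q i else p i) ∧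
        A.card ≤ 2 ^ I.card * (R ^ 2) ^ σ.card := by
  induction I using Finset.induction_on with
  | empty =>
    intro A hA _ h0
    refine ⟨∅, subset_rfl, 0, 0, by simp, fun _ => ?_, ?_⟩
    · obtain ⟨y, hy⟩ := hA
      exact ⟨y, hy, by simp⟩
    · simp only [Finset.card_empty, pow_zero, mul_one]
      refine Finset.card_le_one.mpr fun y hy z hz => ?_
      funext i
      rw [h0 y hy i (by simp), h0 z hz i (by simp)]
  | insert i I hi ih =>
    intro A hA hV h0
    have hcount := card_le_card_image_update_add A V i
      fun y hy => hV y hy i (Finset.mem_insert_self i I)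
    set A' := A.image fun y => Function.update y i 0 with hA'
    have hV' : ∀ y ∈ A', ∀ j ∈ I, y j ∈ V := by
      intro y hy j hj
      obtain ⟨x, hx, rfl⟩ := Finset.mem_image.mp hy
      have hji : j ≠ i := fun h => hi (h ▸ hj)
      simpa [hji] using hV x hx j (Finset.mem_insert_of_mem hj)
    have h0' : ∀ y ∈ A', ∀ j ∉ I, y j = 0 := by
      intro y hy j hj
      obtain ⟨x, hx, rfl⟩ := Finset.mem_image.mp hy
      by_cases hji : j = i
      · subst hji; simp
      · simpa [hji] using h0 x hx j (by simp [hji, hj])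
    rw [Finset.card_insert_of_notMem hi, pow_succ]
    by_cases hbig : A.card ≤ 2 * A'.card
    · obtain ⟨σ, hσ, p, q, hpq, hreal, hcard⟩ := ih A' (hA.image _) hV' h0'
      refine ⟨σ, hσ.trans (Finset.subset_insert i I), p, q, hpq, fun e => ?_, by nlinarith⟩
      obtain ⟨y, hy, hye⟩ := hreal e
      obtain ⟨x, hx, rfl⟩ := Finset.mem_image.mp hy
      refine ⟨x, hx, fun j hj => ?_⟩
      have hji : j ≠ i := fun h => hi (h ▸ hσ hj)
      simpa [hji] using hye j hj
    · obtain ⟨v, hv⟩ : ∃ v : ℤ × ℤ, A.card ≤ 2 * R ^ 2 * (A'.filter fun z =>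
          v.1 < v.2 ∧ Function.update z i v.1 ∈ A ∧ Function.update z i v.2 ∈ A).card := by
        by_contra! hcon
        have h1 : 2 * R ^ 2 * ∑ v ∈ V ×ˢ V, (A'.filter fun z =>
            v.1 < v.2 ∧ Function.update z i v.1 ∈ A ∧ Function.update z i v.2 ∈ A).card
            ≤ R ^ 2 * A.card := by
          rw [Finset.mul_sum]
          refine (Finset.sum_le_card_nsmul _ _ _ fun v _ => (hcon v).le).trans ?_
          rw [Finset.card_product, smul_eq_mul, sq]
          gcongr
        have hR0 : 0 < R ^ 2 := by
          obtain ⟨y, hy⟩ := hA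
          exact pow_pos ((Finset.card_pos.mpr ⟨_, hV y hy i (Finset.mem_insert_self i I)⟩).trans_le
            hR) 2
        rw [mul_assoc, mul_left_comm] at h1
        have h2 := Nat.le_of_mul_le_mul_left h1 hR0
        omega
      set Av := A'.filter fun z =>
          v.1 < v.2 ∧ Function.update z i v.1 ∈ A ∧ Function.update z i v.2 ∈ A with hAv
      have hAvne : Av.Nonempty := by
        rw [← Finset.card_pos]
        exact Nat.pos_of_mul_pos_left ((Finset.card_pos.mpr hA).trans_le hv)
      obtain ⟨z₀, hz₀⟩ := hAvne
      have hlt : v.1 < v.2 := (Finset.mem_filter.mp hz₀).2.1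
      obtain ⟨σ, hσ, p, q, hpq, hreal, hcard⟩ := ih Av ⟨z₀, hz₀⟩
        (fun y hy => hV' y (Finset.mem_filter.mp hy).1)
        (fun y hy => h0' y (Finset.mem_filter.mp hy).1)
      have hiσ : i ∉ σ := fun h => hi (hσ h)
      refine ⟨insert i σ, Finset.insert_subset_insert i hσ, Function.update p i v.1,
        Function.update q i v.2, ?_, fun e => ?_, ?_⟩
      · intro j hj
        by_cases hji : j = i
        · subst hji; simpa using hlt
        · simpa [hji] using hpq j (Finset.mem_of_mem_insert_of_ne hj hji)
      · obtain ⟨z, hz, hze⟩ := hreal e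
        obtain ⟨-, -, hz1, hz2⟩ := Finset.mem_filter.mp hz
        refine ⟨Function.update z i (if e i = 1 then v.2 else v.1), ?_, fun j hj => ?_⟩
        · split_ifs
          · exact hz2
          · exact hz1
        · by_cases hji : j = i
          · subst hji; simp
          · simpa [hji] using hze j (Finset.mem_of_mem_insert_of_ne hj hji)
      · rw [Finset.card_insert_of_notMem hiσ, pow_succ]
        calc A.card ≤ 2 * R ^ 2 * Av.card := hv
          _ ≤ 2 * R ^ 2 * (2 ^ I.card * (R ^ 2) ^ σ.card) := by gcongr
          _ = _ := by ring

end Shatter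
/-! ### Ellipsoids of maximal volume -/

section MaximalVolume

variable {n : ℕ} {N : EuclideanSpace ℝ (Fin n) → ℝ}

namespace IsNormFn

lemma exists_le_mul_norm (hN : IsNormFn N) : ∃ C, 0 < C ∧ ∀ x, N x ≤ C * ‖x‖ := by
  refine ⟨∑ i, N (EuclideanSpace.single i 1) + 1,
    add_pos_of_nonneg_of_pos (Finset.sum_nonneg fun i _ => hN.nonneg _) one_pos, fun x => ?_⟩
  have hsum : ∀ (s : Finset (Fin n)) (v : Fin n → EuclideanSpace ℝ (Fin n)),
      N (∑ i ∈ s, v i) ≤ ∑ i ∈ s, N (v i) := fun s v =>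
    Finset.le_sum_of_subadditive N hN.map_zero.le hN.add_le s v
  have hx : x = ∑ i, x i • EuclideanSpace.single i (1 : ℝ) := by
    ext m
    simp [Pi.single_apply]
  calc N x ≤ ∑ i, N (x i • EuclideanSpace.single i (1 : ℝ)) := by
        conv_lhs => rw [hx]
        exact hsum _ _
    _ ≤ ∑ i, N (EuclideanSpace.single i 1) * ‖x‖ := by
        refine Finset.sum_le_sum fun i _ => ?_
        rw [hN.smul, mul_comm]
        refine mul_le_mul_of_nonneg_left ?_ (hN.nonneg _)
        rw [← Real.norm_eq_abs]
        exact PiLp.norm_apply_le x i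
    _ ≤ _ := by
        rw [← Finset.sum_mul]
        nlinarith [norm_nonneg x]

lemma abs_sub_le (hN : IsNormFn N) (x y : EuclideanSpace ℝ (Fin n)) :
    |N x - N y| ≤ N (x - y) := by
  have h1 := hN.add_le (x - y) y
  have h2 := hN.add_le (y - x) x
  rw [sub_add_cancel] at h1 h2
  rw [← hN.map_neg (y - x), neg_sub] at h2
  exact abs_le.mpr ⟨by linarith, by linarith⟩

lemma continuous (hN : IsNormFn N) : Continuous N := by
  obtain ⟨C, hC, h⟩ := hN.exists_le_mul_norm
  refine LipschitzWith.continuous (K := C.toNNReal) (LipschitzWith.of_dist_le_mul fun x y => ?_)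
  rw [Real.dist_eq, dist_eq_norm, Real.coe_toNNReal C hC.le]
  exact (hN.abs_sub_le x y).trans (h _)

lemma exists_mul_norm_le (hN : IsNormFn N) : ∃ c, 0 < c ∧ ∀ x, c * ‖x‖ ≤ N x := by
  rcases (Metric.sphere (0 : EuclideanSpace ℝ (Fin n)) 1).eq_empty_or_nonempty with h | h
  · refine ⟨1, one_pos, fun x => ?_⟩
    by_cases hx : x = 0
    · simp [hx, hN.map_zero]
    · have : ‖x‖⁻¹ • x ∈ Metric.sphere (0 : EuclideanSpace ℝ (Fin n)) 1 := by
        simp [norm_smul, hx]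
      simp [h] at this
  · obtain ⟨y, hy, hmin⟩ := (isCompact_sphere _ _).exists_isMinOn h hN.continuous.continuousOn
    have hy1 : ‖y‖ = 1 := by simpa using hy
    refine ⟨N y, lt_of_le_of_ne (hN.nonneg y) fun h0 => ?_, fun x => ?_⟩
    · rw [hN.eq_zero y h0.symm] at hy1
      simp at hy1
    · by_cases hx : x = 0
      · simp [hx, hN.map_zero]
      have hx' : 0 < ‖x‖ := norm_pos_iff.mpr hx
      have h1 : N y ≤ N (‖x‖⁻¹ • x) := hmin (by simp [norm_smul, hx])
      rwa [hN.smul, abs_of_pos (inv_pos.mpr hx'), inv_mul_eq_div, le_div_iff₀ hx'] at h1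

lemma isCompact_unitBall (hN : IsNormFn N) : IsCompact {x | N x ≤ 1} := by
  obtain ⟨c, hc, h⟩ := hN.exists_mul_norm_le
  refine (isCompact_closedBall (0 : EuclideanSpace ℝ (Fin n)) (1 / c)).of_isClosed_subset
    (isClosed_le hN.continuous continuous_const) fun x hx => ?_
  rw [mem_closedBall_zero_iff, le_div_iff₀ hc, mul_comm]
  exact (h x).trans hx

lemma comp_injective (hN : IsNormFn N)
    (L : EuclideanSpace ℝ (Fin n) ≃ₗ[ℝ] EuclideanSpace ℝ (Fin n)) :
    IsNormFn fun x => N (L x) where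
  add_le x y := by simpa using hN.add_le (L x) (L y)
  smul t x := by simpa using hN.smul t (L x)
  eq_zero x hx := by simpa using hN.eq_zero _ hx

end IsNormFn

/-- The euclidean unit ball is an ellipsoid of maximal volume in the unit ball of `N`. -/
structure IsMaximalPosition (N : EuclideanSpace ℝ (Fin n) → ℝ) : Prop where
  le_norm : ∀ x, N x ≤ ‖x‖
  abs_det_le : ∀ A : EuclideanSpace ℝ (Fin n) →ₗ[ℝ] EuclideanSpace ℝ (Fin n),
    (∀ x, N (A x) ≤ ‖x‖) → |LinearMap.det A| ≤ 1

lemma IsNormFn.exists_isMaximalPosition (hN : IsNormFn N) :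
    ∃ L : EuclideanSpace ℝ (Fin n) ≃ₗ[ℝ] EuclideanSpace ℝ (Fin n),
      IsMaximalPosition fun x => N (L x) := by
  obtain ⟨C, hC, hNC⟩ := hN.exists_le_mul_norm
  obtain ⟨c, hc, hcN⟩ := hN.exists_mul_norm_le
  set K : Set (EuclideanSpace ℝ (Fin n) →L[ℝ] EuclideanSpace ℝ (Fin n)) :=
    {L | ∀ x, N (L x) ≤ ‖x‖} with hK
  have hcompact : IsCompact K := by
    have : ProperSpace (EuclideanSpace ℝ (Fin n) →L[ℝ] EuclideanSpace ℝ (Fin n)) :=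
      FiniteDimensional.proper ℝ _
    refine (isCompact_closedBall
      (0 : EuclideanSpace ℝ (Fin n) →L[ℝ] EuclideanSpace ℝ (Fin n)) (1 / c)).of_isClosed_subset
      ?_ ?_
    · rw [hK, Set.ofPred_forall]
      refine isClosed_iInter fun x => ?_
      exact isClosed_le (hN.continuous.comp (continuous_eval_const x)) continuous_const
    · intro L hL
      rw [mem_closedBall_zero_iff]
      refine L.opNorm_le_bound (by positivity) fun x => ?_
      rw [one_div, inv_mul_eq_div, le_div_iff₀ hc, mul_comm]
      exact (hcN _).trans (hL x)
  have hne : (C⁻¹ • ContinuousLinearMap.id ℝ (EuclideanSpace ℝ (Fin n))) ∈ K := by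
    intro x
    change N (C⁻¹ • x) ≤ ‖x‖
    rw [hN.smul, abs_of_pos (inv_pos.mpr hC), inv_mul_eq_div, div_le_iff₀ hC, mul_comm]
    exact hNC x
  obtain ⟨L, hLK, hmax⟩ := hcompact.exists_isMaxOn ⟨_, hne⟩
    (f := fun L => |L.det|) ContinuousLinearMap.continuous_det.abs.continuousOn
  have hdet : 0 < |L.det| := by
    refine lt_of_lt_of_le ?_ (hmax hne)
    rw [abs_pos]
    simp [ContinuousLinearMap.det, LinearMap.det_smul, hC.ne']
  refine ⟨LinearMap.equivOfDetNeZero (L : EuclideanSpace ℝ (Fin n) →ₗ[ℝ] EuclideanSpace ℝ (Fin n))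
    (abs_pos.mp hdet), ⟨fun x => hLK x, fun A hA => ?_⟩⟩
  have hmem : L.comp (LinearMap.toContinuousLinearMap A) ∈ K := fun x => hA x
  have h1 : |(L.comp (LinearMap.toContinuousLinearMap A)).det| ≤ |L.det| := hmax hmem
  have h2 : (L.comp (LinearMap.toContinuousLinearMap A)).det = L.det * LinearMap.det A := by
    simp [ContinuousLinearMap.det]
  rw [h2, abs_mul] at h1
  exact le_of_mul_le_mul_left (by simpa using h1) hdet

namespace IsMaximalPosition

lemma trace_le (h : IsMaximalPosition N) (hN : IsNormFn N)
    (T : EuclideanSpace ℝ (Fin n) →ₗ[ℝ] EuclideanSpace ℝ (Fin n)) {t : ℝ} (ht : 0 ≤ t)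
    (hT : ∀ x, N (T x) ≤ t * ‖x‖) : LinearMap.trace ℝ _ T ≤ n * t := by
  set b := (EuclideanSpace.basisFun (Fin n) ℝ).toBasis with hb
  set A := LinearMap.toMatrix b b T with hA
  have hdet : ∀ s : ℝ, LinearMap.det (1 + s • T) = (1 + s • A).det := by
    intro s
    rw [← LinearMap.det_toMatrix b, map_add, map_smul, LinearMap.toMatrix_one]
  have htr : LinearMap.trace ℝ _ T = A.trace := LinearMap.trace_eq_matrix_trace ℝ b T
  have hbound : ∀ s : ℝ, 0 ≤ s → (1 + s • A).det ≤ (1 + s * t) ^ n := by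
    intro s hs
    have hst : 0 < 1 + s * t := by positivity
    have h1 := h.abs_det_le ((1 + s * t)⁻¹ • (1 + s • T)) fun x => by
      rw [LinearMap.smul_apply, hN.smul, abs_of_pos (inv_pos.mpr hst), inv_mul_eq_div,
        div_le_iff₀ hst]
      calc N ((1 + s • T) x) ≤ N x + N (s • T x) := by simpa using hN.add_le x (s • T x)
        _ ≤ ‖x‖ + s * (t * ‖x‖) := by
            rw [hN.smul, abs_of_nonneg hs]
            gcongr
            · exact h.le_norm x
            · exact hT x
        _ = ‖x‖ * (1 + s * t) := by ring
    rw [LinearMap.det_smul, hdet, abs_mul, finrank_euclideanSpace_fin, inv_pow,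
      abs_of_pos (inv_pos.mpr (pow_pos hst n)), inv_mul_eq_div, div_le_iff₀ (pow_pos hst n),
      one_mul] at h1
    exact (le_abs_self _).trans h1
  rw [htr]
  set P := (Matrix.det (1 + (Polynomial.X : Polynomial ℝ) • A.map Polynomial.C)).divX.divX with hP
  have hderiv : HasDerivAt (fun s : ℝ => (1 + s * t) ^ n - (1 + A.trace * s + P.eval s * s ^ 2))
      (n * t - A.trace) 0 := by
    have h1 : HasDerivAt (fun s : ℝ => (1 + s * t) ^ n) (n * (1 + 0 * t) ^ (n - 1) * (1 * t)) 0 :=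
      (((hasDerivAt_id (0 : ℝ)).mul_const t).const_add 1).pow n
    have h2 : HasDerivAt (fun s : ℝ => 1 + A.trace * s) (A.trace * 1) 0 :=
      ((hasDerivAt_id (0 : ℝ)).const_mul A.trace).const_add 1
    have h3 : HasDerivAt (fun s : ℝ => P.eval s * s ^ 2)
        (P.derivative.eval 0 * 0 ^ 2 + P.eval 0 * (2 * 0)) 0 := by
      simpa using (P.hasDerivAt 0).fun_mul ((hasDerivAt_id' (0 : ℝ)).fun_pow 2)
    have h5 := h1.fun_sub (h2.fun_add h3)
    simpa [add_assoc] using h5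
  have hslope := (hasDerivWithinAt_iff_tendsto_slope' (s := Set.Ioi (0 : ℝ)) (by simp)).mp
    hderiv.hasDerivWithinAt
  have := ge_of_tendsto hslope (b := 0) (by
    filter_upwards [self_mem_nhdsWithin] with s hs
    have hs0 : 0 < s := hs
    have h5 := hbound s hs0.le
    rw [Matrix.det_one_add_smul] at h5
    rw [slope_def_field]
    refine div_nonneg ?_ (by linarith)
    simpa using h5)
  linarith

lemma norm_le (h : IsMaximalPosition N) (hN : IsNormFn N) (x : EuclideanSpace ℝ (Fin n)) :
    ‖x‖ ≤ n * N x := by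
  by_cases hx : x = 0
  · simp [hx, hN.map_zero]
  have hx' : 0 < ‖x‖ := norm_pos_iff.mpr hx
  have h1 := h.trace_le hN
    (((innerSL ℝ (‖x‖⁻¹ • x) : EuclideanSpace ℝ (Fin n) →L[ℝ] ℝ) :
      EuclideanSpace ℝ (Fin n) →ₗ[ℝ] ℝ).smulRight x) (hN.nonneg x) fun z => by
    rw [LinearMap.smulRight_apply, hN.smul, mul_comm]
    refine mul_le_mul_of_nonneg_left ?_ (hN.nonneg x)
    refine (abs_real_inner_le_norm (‖x‖⁻¹ • x) z).trans ?_
    rw [norm_smul, norm_inv, norm_norm, inv_mul_cancel₀ hx'.ne', one_mul]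
  rw [LinearMap.trace_smulRight] at h1
  refine le_trans (le_of_eq ?_) h1
  simp
  field_simp

lemma exists_mem_unit (h : IsMaximalPosition N) (hN : IsNormFn N)
    (F : Submodule ℝ (EuclideanSpace ℝ (Fin n))) (hF : 0 < Module.finrank ℝ F) :
    ∃ y ∈ F, ‖y‖ = 1 ∧ (Module.finrank ℝ F : ℝ) / (2 * n) ≤ N y := by
  have hn : 0 < n := by
    have := F.finrank_le
    rw [finrank_euclideanSpace_fin] at this
    omega
  set k := Module.finrank ℝ F with hk
  have hn' : (0 : ℝ) < n := by exact_mod_cast hn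
  have hk' : (0 : ℝ) < k := by exact_mod_cast hF
  set T : EuclideanSpace ℝ (Fin n) →ₗ[ℝ] EuclideanSpace ℝ (Fin n) :=
    F.starProjection.toLinearMap with hT
  have htr : LinearMap.trace ℝ _ T = k := by
    refine LinearMap.IsProj.trace (p := F) ⟨fun x => ?_, fun x hx => ?_⟩
    · exact F.starProjection_apply_mem x
    · exact Submodule.starProjection_eq_self_iff.mpr hx
  obtain ⟨x, hx⟩ : ∃ x, (k : ℝ) / (2 * n) * ‖x‖ < N (T x) := by
    by_contra! hcon
    have h1 := h.trace_le hN T (t := (k : ℝ) / (2 * n)) (by positivity) hcon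
    rw [htr] at h1
    have h2 : (n : ℝ) * (k / (2 * n)) = k / 2 := by field_simp
    linarith
  have hTx : T x ≠ 0 := by
    intro h0
    rw [h0, hN.map_zero] at hx
    exact absurd hx (not_lt.mpr (by positivity))
  have hTx' : 0 < ‖T x‖ := norm_pos_iff.mpr hTx
  have hle : ‖T x‖ ≤ ‖x‖ := F.norm_starProjection_apply_le x
  refine ⟨‖T x‖⁻¹ • T x, F.smul_mem _ (F.starProjection_apply_mem x), ?_, ?_⟩
  · rw [norm_smul, norm_inv, norm_norm, inv_mul_cancel₀ hTx'.ne']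
  · rw [hN.smul, abs_of_pos (inv_pos.mpr hTx'), inv_mul_eq_div, le_div_iff₀ hTx']
    refine le_trans ?_ hx.le
    gcongr

lemma exists_triangular (h : IsMaximalPosition N) (hN : IsNormFn N) (m : ℕ) (hm : m ≤ n) :
    ∃ (x : ℕ → EuclideanSpace ℝ (Fin n)) (u : ℕ → EuclideanSpace ℝ (Fin n) →ₗ[ℝ] ℝ),
      ∀ j < m, ‖x j‖ = 1 ∧ (∀ z, |u j z| ≤ N z) ∧ ((n : ℝ) - j) / (2 * n) ≤ u j (x j) ∧
        ∀ i < j, u i (x j) = 0 := by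
  induction m with
  | zero => exact ⟨0, 0, by simp⟩
  | succ m ih =>
    obtain ⟨x, u, hxu⟩ := ih (by omega)
    set Φ : EuclideanSpace ℝ (Fin n) →ₗ[ℝ] (Fin m → ℝ) := LinearMap.pi fun i => u i with hΦ
    have hrank := LinearMap.finrank_range_add_finrank_ker Φ
    have hrange : Module.finrank ℝ (LinearMap.range Φ) ≤ m := by
      simpa using (LinearMap.range Φ).finrank_le
    rw [finrank_euclideanSpace_fin] at hrank
    obtain ⟨y, hy, hy1, hNy⟩ := h.exists_mem_unit hN (LinearMap.ker Φ) (by omega)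
    obtain ⟨g, hg, hgN⟩ := hN.exists_functional y
    refine ⟨Function.update x m y, Function.update u m g, fun j hj => ?_⟩
    rcases Nat.lt_succ_iff_lt_or_eq.mp hj with hj | rfl
    · rw [Function.update_of_ne hj.ne, Function.update_of_ne hj.ne]
      obtain ⟨h1, h2, h3, h4⟩ := hxu j hj
      refine ⟨h1, h2, h3, fun i hi => ?_⟩
      rw [Function.update_of_ne (hi.trans hj).ne]
      exact h4 i hi
    · rw [Function.update_self, Function.update_self]
      refine ⟨hy1, hgN, ?_, fun i hi => ?_⟩
      · rw [hg]
        refine le_trans ?_ hNy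
        gcongr
        rw [sub_le_iff_le_add]
        exact_mod_cast (by omega)
      · rw [Function.update_of_ne hi.ne]
        exact congrFun (LinearMap.mem_ker.mp hy) ⟨i, hi⟩

end IsMaximalPosition

lemma abs_det_le_one_of_norm_eq_one (x : Fin n → EuclideanSpace ℝ (Fin n))
    (hx : ∀ j, ‖x j‖ = 1) : |(Matrix.of fun l j => x j l).det| ≤ 1 := by
  have : Fact (Module.finrank ℝ (EuclideanSpace ℝ (Fin n)) = n) := ⟨finrank_euclideanSpace_fin⟩
  set b := EuclideanSpace.basisFun (Fin n) ℝ with hb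
  have h1 := b.toBasis.orientation.abs_volumeForm_apply_le x
  rw [b.toBasis.orientation.volumeForm_robust' b] at h1
  simp only [hx, Finset.prod_const_one] at h1
  refine le_trans (le_of_eq ?_) h1
  rw [Module.Basis.det_apply]
  congr 2

/-- In maximal position there are `n` functionals in the dual unit ball whose determinant is only
exponentially small. -/
lemma IsMaximalPosition.exists_matrix (h : IsMaximalPosition N) (hN : IsNormFn N) :
    ∃ U : Matrix (Fin n) (Fin n) ℝ, (∀ z i, |U.mulVec z.ofLp i| ≤ N z) ∧
      (2 * Real.exp 1)⁻¹ ^ n ≤ |U.det| := by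
  obtain ⟨x, u, hxu⟩ := h.exists_triangular hN n le_rfl
  set U : Matrix (Fin n) (Fin n) ℝ := Matrix.of fun i l => u i (EuclideanSpace.single l 1) with hU
  have hmul : ∀ z i, U.mulVec z.ofLp i = u i z := by
    intro z i
    have hz : z = ∑ l, z l • EuclideanSpace.single l (1 : ℝ) := by
      ext m
      simp [Pi.single_apply]
    conv_rhs => rw [hz]
    simp [Matrix.mulVec, dotProduct, hU, map_sum, mul_comm]
  refine ⟨U, fun z i => by rw [hmul]; exact (hxu i i.2).2.1 z, ?_⟩
  set X : Matrix (Fin n) (Fin n) ℝ := Matrix.of fun l j => x j l with hX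
  have hUX : ∀ i j, (U * X) i j = u i (x j) := fun i j => by
    rw [← hmul]; rfl
  have hX1 : |X.det| ≤ 1 := abs_det_le_one_of_norm_eq_one (fun j => x j) fun j => (hxu j j.2).1
  have htri : (U * X).det = ∏ i, (U * X) i i := by
    refine Matrix.det_of_isLowerTriangular _ fun i j hij => ?_
    rw [hUX]
    exact (hxu j j.2).2.2.2 i hij
  have hprod : ∏ i : Fin n, ((n : ℝ) - i) / (2 * n) ≤ (U * X).det := by
    rw [htri]
    refine Finset.prod_le_prod (fun i _ => ?_) fun i _ => ?_
    · have : ((i : ℕ) : ℝ) ≤ n := by exact_mod_cast i.2.le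
      exact div_nonneg (by linarith) (by positivity)
    · rw [hUX]
      exact (hxu i i.2).2.2.1
  have hfact : ∏ i : Fin n, ((n : ℝ) - i) = (n.factorial : ℝ) := by
    rw [Fin.prod_univ_eq_prod_range (fun i => (n : ℝ) - i), ← Nat.descFactorial_self,
      Nat.descFactorial_eq_prod_range]
    push_cast
    refine Finset.prod_congr rfl fun i hi => ?_
    rw [Nat.cast_sub (Finset.mem_range.mp hi).le]
  rw [Finset.prod_div_distrib, hfact, Finset.prod_const, Finset.card_univ, Fintype.card_fin]
    at hprod
  have hexp := Real.pow_div_factorial_le_exp (n : ℝ) (by positivity) n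
  calc (2 * Real.exp 1)⁻¹ ^ n ≤ n.factorial / (2 * n : ℝ) ^ n := by
        rcases Nat.eq_zero_or_pos n with rfl | hn
        · simp
        rw [inv_pow, ← one_div, div_le_div_iff₀ (by positivity) (by positivity), mul_pow, mul_pow,
          ← Real.exp_nat_mul, mul_one, one_mul, mul_left_comm]
        rw [div_le_iff₀ (by positivity)] at hexp
        gcongr
        linarith
    _ ≤ (U * X).det := hprod
    _ ≤ |U.det| * |X.det| := by rw [← abs_mul, ← Matrix.det_mul]; exact le_abs_self _
    _ ≤ |U.det| := mul_le_of_le_one_right (abs_nonneg _) hX1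

end MaximalVolume
/-! ### From volume to sign patterns -/

section Volume

variable {n : ℕ}

/-- A set of large volume contains many points of some translate of a scaled integer lattice. -/
lemma exists_translate_card_lt {Y : Set (Fin n → ℝ)} (hY : MeasurableSet Y) {h : ℝ} (hh : 0 < h)
    (hYb : ∀ y ∈ Y, ∀ i, |y i| ≤ 1) {M : ℕ}
    (hvol : ENNReal.ofReal (M * h ^ n) < volume Y) :
    ∃ (s : Fin n → ℝ) (A : Finset (Fin n → ℤ)), M < A.card ∧
      ∀ z ∈ A, (∀ i, z i ∈ Finset.Icc ⌊-(1 / h)⌋ ⌊1 / h⌋) ∧ (fun i => s i + h * z i) ∈ Y := by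
  classical
  by_contra! hcon
  refine absurd hvol (not_lt.mpr ?_)
  set B : Finset (Fin n → ℤ) := Fintype.piFinset fun _ => Finset.Icc ⌊-(1 / h)⌋ ⌊1 / h⌋ with hB
  set Q : Set (Fin n → ℝ) := Set.univ.pi fun _ => Set.Ico 0 h with hQ
  have hQm : MeasurableSet Q := MeasurableSet.univ_pi fun _ => measurableSet_Ico
  have hQvol : volume Q = ENNReal.ofReal (h ^ n) := by
    rw [hQ, volume_pi_pi]
    simp [ENNReal.ofReal_pow hh.le]
  set g : (Fin n → ℤ) → (Fin n → ℝ) := fun z i => h * z i with hg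
  set S : (Fin n → ℤ) → Set (Fin n → ℝ) := fun z => (fun s => s + g z) ⁻¹' Y with hS
  have hSm : ∀ z, MeasurableSet (S z) := fun z => (measurable_add_const (g z)) hY
  have hcover : Y ⊆ ⋃ z ∈ B, (fun s => s - g z) ⁻¹' (Q ∩ S z) := by
    intro y hy
    have hy1 : ∀ i, -(1 / h) ≤ y i / h ∧ y i / h ≤ 1 / h := fun i => by
      obtain ⟨h1, h2⟩ := abs_le.mp (hYb y hy i)
      rw [← neg_div]
      exact ⟨by gcongr, by gcongr⟩
    refine Set.mem_biUnion (x := fun i => ⌊y i / h⌋) ?_ ?_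
    · refine Finset.mem_coe.mpr (Fintype.mem_piFinset.mpr fun i => Finset.mem_Icc.mpr
        ⟨Int.floor_le_floor (hy1 i).1, Int.floor_le_floor (hy1 i).2⟩)
    · refine ⟨fun i _ => ?_, ?_⟩
      · have h1 := Int.floor_le (y i / h)
        have h2 := Int.lt_floor_add_one (y i / h)
        rw [le_div_iff₀ hh] at h1
        rw [div_lt_iff₀ hh] at h2
        simp only [hg, Pi.sub_apply, Set.mem_Ico]
        constructor <;> linarith
      · simpa [hS] using hy
  calc volume Y ≤ ∑ z ∈ B, volume ((fun s => s - g z) ⁻¹' (Q ∩ S z)) :=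
        (measure_mono hcover).trans (measure_biUnion_finset_le _ _)
    _ = ∑ z ∈ B, ∫⁻ s in Q, (S z).indicator 1 s := by
        refine Finset.sum_congr rfl fun z _ => ?_
        simp only [sub_eq_add_neg]
        rw [measure_preimage_add_right, lintegral_indicator_one (hSm z),
          Measure.restrict_apply (hSm z), Set.inter_comm]
    _ = ∫⁻ s in Q, ∑ z ∈ B, (S z).indicator 1 s :=
        (lintegral_finsetSum _ fun z _ => measurable_one.indicator (hSm z)).symm
    _ ≤ ∫⁻ _ in Q, (M : ENNReal) := by
        refine lintegral_mono fun s => ?_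
        have h1 : ∑ z ∈ B, (S z).indicator (1 : (Fin n → ℝ) → ENNReal) s
            = ((B.filter fun z => s ∈ S z).card : ENNReal) := by
          rw [Finset.card_filter]
          push_cast
          refine Finset.sum_congr rfl fun z _ => ?_
          simp [Set.indicator_apply]
        rw [h1]
        by_contra! hlt
        obtain ⟨z, hz, hz'⟩ := hcon s (B.filter fun z => s ∈ S z) (by exact_mod_cast hlt)
        obtain ⟨hzB, hzS⟩ := Finset.mem_filter.mp hz
        exact hz' (Fintype.mem_piFinset.mp hzB) hzS
    _ = ENNReal.ofReal (M * h ^ n) := by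
        rw [setLIntegral_const, hQvol, ENNReal.ofReal_mul (by positivity), ENNReal.ofReal_natCast]

/-- A subset of the cube whose volume radius is bounded below has, on proportionally many
coordinates, points of every sign pattern. -/
lemma exists_sign_patterns {Y : Set (Fin n → ℝ)} (hY : MeasurableSet Y) {h : ℝ} (hh : 0 < h)
    (hYb : ∀ y ∈ Y, ∀ i, |y i| ≤ 1) (hvol : ENNReal.ofReal ((8 * h) ^ n) ≤ volume Y) (hn : 0 < n)
    {R : ℕ} (hR : (Finset.Icc ⌊-(1 / h)⌋ ⌊1 / h⌋).card ≤ R) :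
    ∃ (σ : Finset (Fin n)) (c r : Fin n → ℝ), n * Real.log 2 ≤ 2 * σ.card * Real.log R ∧
      (∀ i ∈ σ, h / 2 ≤ r i) ∧
      ∀ e : Fin n → ℤˣ, ∃ y ∈ Y, ∀ i ∈ σ, y i = c i + signVal (e i) * r i := by
  obtain ⟨s, A, hcard, hA⟩ := exists_translate_card_lt hY hh hYb (M := 4 ^ n) (by
    refine lt_of_lt_of_le ?_ hvol
    rw [ENNReal.ofReal_lt_ofReal_iff (by positivity)]
    push_cast
    rw [mul_pow]
    gcongr
    norm_num)
  obtain ⟨σ, -, p, q, hpq, hreal, hle⟩ := exists_shattered _ hR Finset.univ A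
    (Finset.card_pos.mp ((Nat.zero_le _).trans_lt hcard)) (fun y hy i _ => (hA y hy).1 i) (by simp)
  refine ⟨σ, fun i => s i + h * ((p i + q i) / 2), fun i => h * ((q i - p i) / 2), ?_,
    fun i hi => ?_, fun e => ?_⟩
  · have h1 : (2 : ℝ) ^ n * 2 ^ n ≤ 2 ^ n * ((R : ℝ) ^ 2) ^ σ.card := by
      rw [← mul_pow]
      norm_num only
      rw [Finset.card_univ, Fintype.card_fin] at hle
      exact_mod_cast hcard.le.trans hle
    have h2 : (2 : ℝ) ^ n ≤ ((R : ℝ) ^ 2) ^ σ.card := le_of_mul_le_mul_left h1 (by positivity)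
    have h3 := Real.log_le_log (by positivity) h2
    rw [Real.log_pow, Real.log_pow, Real.log_pow] at h3
    push_cast at h3
    linarith
  · have h1 : (p i : ℝ) + 1 ≤ q i := by exact_mod_cast hpq i hi
    nlinarith
  · obtain ⟨z, hz, hze⟩ := hreal e
    refine ⟨_, (hA z hz).2, fun i hi => ?_⟩
    simp only [hze i hi]
    rcases Int.units_eq_one_or (e i) with h1 | h1
    · simp only [h1, if_true, signVal_one]; ring
    · rw [h1, if_neg (by decide), signVal_neg_one]; ring

/-- The image of the unit ball under the matrix `U`, as a subset of the coordinate space. -/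
lemma volume_mulVec_image (U : Matrix (Fin n) (Fin n) ℝ) (K : Set (EuclideanSpace ℝ (Fin n))) :
    volume ((fun z : EuclideanSpace ℝ (Fin n) => U.mulVec z.ofLp) '' K)
      = ENNReal.ofReal |U.det| * volume K := by
  have h1 : (fun z : EuclideanSpace ℝ (Fin n) => U.mulVec z.ofLp) '' K
      = Matrix.toLin' U '' ((WithLp.ofLp : EuclideanSpace ℝ (Fin n) → Fin n → ℝ) '' K) := by
    rw [Set.image_image]
    rfl
  rw [h1, Measure.addHaar_image_linearMap, LinearMap.det_toLin']
  congr 1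
  have h2 : (WithLp.ofLp : EuclideanSpace ℝ (Fin n) → Fin n → ℝ) '' K
      = MeasurableEquiv.toLp 2 (Fin n → ℝ) ⁻¹' K := by
    rw [← MeasurableEquiv.image_symm]
    rfl
  rw [h2]
  exact ((EuclideanSpace.volume_preserving_symm_measurableEquiv_toLp
    (Fin n)).symm).measure_preimage_equiv K

lemma pow_two_div_sqrt_le_volume_ball (hn : 0 < n) :
    (2 / Real.sqrt n) ^ n
      ≤ (volume (Metric.closedBall (0 : EuclideanSpace ℝ (Fin n)) 1)).toReal := by
  have hn' : (0 : ℝ) < n := by exact_mod_cast hn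
  have hs : 0 < Real.sqrt n := Real.sqrt_pos.mpr hn'
  set C : Set (EuclideanSpace ℝ (Fin n)) := WithLp.ofLp ⁻¹'
    (Set.univ.pi fun _ => Set.Icc (-(1 / Real.sqrt n)) (1 / Real.sqrt n)) with hC
  have hCvol : volume C = ENNReal.ofReal ((2 / Real.sqrt n) ^ n) := by
    rw [hC, (PiLp.volume_preserving_ofLp (Fin n)).measure_preimage
      (MeasurableSet.univ_pi fun _ => measurableSet_Icc).nullMeasurableSet, volume_pi_pi]
    simp only [Real.volume_Icc, Finset.prod_const, Finset.card_univ, Fintype.card_fin]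
    rw [← ENNReal.ofReal_pow (by ring_nf; positivity)]
    congr 2
    ring
  have hsub : C ⊆ Metric.closedBall 0 1 := by
    intro x hx
    rw [mem_closedBall_zero_iff, EuclideanSpace.norm_eq, Real.sqrt_le_one]
    calc ∑ i, ‖x i‖ ^ 2 ≤ ∑ _i : Fin n, (1 / Real.sqrt n) ^ 2 := by
          refine Finset.sum_le_sum fun i _ => ?_
          gcongr
          exact abs_le.mpr (hx i (Set.mem_univ i))
      _ = 1 := by
          rw [Finset.sum_const, Finset.card_univ, Fintype.card_fin, nsmul_eq_mul, div_pow,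
            Real.sq_sqrt hn'.le]
          field_simp
  rw [← ENNReal.ofReal_le_iff_le_toReal measure_closedBall_lt_top.ne, ← hCvol]
  exact measure_mono hsub

end Volume
/-! ### Embedding the cube -/

section Assembly

lemma IsNormFn.apply_sum_le_of_signed_sums_le {E : Type*} [AddCommGroup E] [Module ℝ E] {N : E → ℝ}
    (hN : IsNormFn N) {κ : Type*} [Fintype κ] {x : κ → E} {K : ℝ}
    (h : ∀ ε : κ → ℤˣ, N (∑ i, signVal (ε i) • x i) ≤ K) (a : κ → ℝ) {t : ℝ} (ht : 0 ≤ t)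
    (ha : ∀ i, |a i| ≤ t) : N (∑ i, a i • x i) ≤ K * t := by
  obtain ⟨g, hg, hgN⟩ := hN.exists_functional (∑ i, a i • x i)
  set ε : κ → ℤˣ := fun i => if 0 ≤ g (x i) then 1 else -1 with hε
  have hsign : ∀ i, signVal (ε i) * g (x i) = |g (x i)| := by
    intro i
    simp only [hε]
    split_ifs with h0
    · rw [signVal_one, one_mul, abs_of_nonneg h0]
    · rw [signVal_neg_one, abs_of_neg (not_le.mp h0)]; ring
  rw [← hg, map_sum]
  calc ∑ i, g (a i • x i) ≤ ∑ i, t * (signVal (ε i) * g (x i)) := by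
        refine Finset.sum_le_sum fun i _ => ?_
        rw [map_smul, smul_eq_mul, hsign]
        refine (le_abs_self _).trans ?_
        rw [abs_mul]
        gcongr
        exact ha i
    _ = t * g (∑ i, signVal (ε i) • x i) := by
        rw [map_sum, ← Finset.mul_sum]
        simp
    _ ≤ t * K := by
        gcongr
        exact ((le_abs_self _).trans (hgN _)).trans (h ε)
    _ = K * t := mul_comm _ _

lemma expect_signVal {κ : Type*} [Fintype κ] [DecidableEq κ] (i : κ) :
    𝔼 ε : κ → ℤˣ, signVal (ε i) = 0 := by
  rw [expect_signs_flip i]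
  refine (Finset.expect_congr rfl fun ε _ => ?_).trans (Finset.expect_const_zero _)
  simp [signVal]

variable {n : ℕ} {N : EuclideanSpace ℝ (Fin n) → ℝ}

/-- Averaging points that realise all sign patterns yields a biorthogonal system whose Rademacher
sums are controlled. -/
lemma exists_biorthogonal (hN : IsNormFn N) (h1 : ∀ x, N x ≤ ‖x‖) (h2 : ∀ x, ‖x‖ ≤ n * N x)
    {d : ℕ} (hd : 1 ≤ d) (hnd : (n : ℝ) * ((1 + n ^ 2) / 2) ≤ 2 ^ d)
    {κ : Type*} [Fintype κ] [DecidableEq κ] (u : κ → EuclideanSpace ℝ (Fin n) →ₗ[ℝ] ℝ)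
    (c r : κ → ℝ) (h : ∀ e : κ → ℤˣ, ∃ z, N z ≤ 1 ∧ ∀ i, u i z = c i + signVal (e i) * r i) :
    ∃ x : κ → EuclideanSpace ℝ (Fin n), (∀ i j, u j (x i) = if i = j then r j else 0) ∧
      𝔼 ε : κ → ℤˣ, N (∑ i, signVal (ε i) • x i) ^ 2 ≤ (40 * d) ^ 2 := by
  choose f hf hfu using h
  set x : κ → EuclideanSpace ℝ (Fin n) := fun i =>
    (Fintype.card (κ → ℤˣ) : ℝ)⁻¹ • ∑ ε : κ → ℤˣ, signVal (ε i) • f ε with hx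
  have hxg : ∀ (g : EuclideanSpace ℝ (Fin n) →ₗ[ℝ] ℝ) (i : κ),
      g (x i) = 𝔼 ε, signVal (ε i) * g (f ε) := by
    intro g i
    rw [Fintype.expect_eq_sum_div_card, hx]
    simp only [map_smul, map_sum, smul_eq_mul]
    rw [div_eq_inv_mul]
  refine ⟨x, fun i j => ?_, expect_sq_rademacher_le hN h1 h2 hd hnd f hf x hxg⟩
  rw [hxg]
  calc 𝔼 ε : κ → ℤˣ, signVal (ε i) * u j (f ε)
      = 𝔼 ε : κ → ℤˣ, (signVal (ε i) * c j + signVal (ε i) * signVal (ε j) * r j) := by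
        refine Finset.expect_congr rfl fun ε _ => ?_
        rw [hfu]; ring
    _ = if i = j then r j else 0 := by
        rw [Finset.expect_add_distrib, ← Finset.expect_mul, ← Finset.expect_mul, expect_signVal,
          expect_signVal_mul_signVal]
        split_ifs <;> simp

/-- A norm in maximal position whose unit ball has large volume is equivalent to the sup norm, up
to a logarithmic factor, on the span of a long sequence of vectors. -/
lemma IsMaximalPosition.exists_cube (hmax : IsMaximalPosition N) (hN : IsNormFn N) (hn : 0 < n)
    {U : Matrix (Fin n) (Fin n) ℝ} (hU : ∀ z i, |U.mulVec z.ofLp i| ≤ N z) {h : ℝ} (hh : 0 < h)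
    (hvol : ENNReal.ofReal ((8 * h) ^ n) ≤ ENNReal.ofReal |U.det| * volume {x | N x ≤ 1})
    {R : ℕ} (hR1 : 1 < R) (hR : (Finset.Icc ⌊-(1 / h)⌋ ⌊1 / h⌋).card ≤ R)
    {d : ℕ} (hd : 1 ≤ d) (hnd : (n : ℝ) * ((1 + n ^ 2) / 2) ≤ 2 ^ d) :
    ∃ (m : ℕ) (x : Fin m → EuclideanSpace ℝ (Fin n)),
      n * Real.log 2 ≤ 200 * m ^ 2 * Real.log R ∧
      ∀ a : Fin m → ℝ, h / 2 * ‖a‖ ≤ N (∑ i, a i • x i) ∧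
        N (∑ i, a i • x i) ≤ 480 * d * ‖a‖ := by
  have hlogR : 0 < Real.log R := Real.log_pos (by exact_mod_cast hR1)
  set Y := (fun z : EuclideanSpace ℝ (Fin n) => U.mulVec z.ofLp) '' {x | N x ≤ 1} with hY
  have hcont : Continuous fun z : EuclideanSpace ℝ (Fin n) => U.mulVec z.ofLp := by fun_prop
  obtain ⟨σ, c, r, hσ, hr, hpat⟩ := exists_sign_patterns
    (hN.isCompact_unitBall.image hcont).measurableSet hh (by
      rintro _ ⟨z, hz, rfl⟩ i
      exact (hU z i).trans hz) (by rwa [volume_mulVec_image]) hn hR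
  set u : Fin n → EuclideanSpace ℝ (Fin n) →ₗ[ℝ] ℝ := fun j =>
    LinearMap.proj j ∘ₗ Matrix.toLin' U ∘ₗ (WithLp.linearEquiv 2 ℝ (Fin n → ℝ)).toLinearMap with hu
  have huU : ∀ j z, u j z = U.mulVec z.ofLp j := fun j z => rfl
  obtain ⟨x, hxu, hxN⟩ := exists_biorthogonal hN hmax.le_norm (hmax.norm_le hN) hd hnd
    (fun i : σ => u i) (fun i => c i) (fun i => r i) fun e => by
      obtain ⟨_, ⟨z, hz, rfl⟩, hzi⟩ := hpat fun i => if hi : i ∈ σ then e ⟨i, hi⟩ else 1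
      refine ⟨z, hz, fun i => ?_⟩
      have := hzi i i.2
      simpa [huU] using this
  have hσ0 : 0 < σ.card := by
    by_contra! h0
    have h0' : σ.card = 0 := by omega
    rw [h0'] at hσ
    have : 0 < n * Real.log 2 := mul_pos (by exact_mod_cast hn) (Real.log_pos (by norm_num))
    simp at hσ
    linarith
  have hd0 : (0 : ℝ) < d := by exact_mod_cast hd
  obtain ⟨σ', hcard, hsigned⟩ := exists_subset_signed_sums_le hN (by simpa using hσ0) x
    (M := 40 * d) (by positivity) hxN
  rw [Fintype.card_coe] at hcard
  set e := σ'.equivFin with he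
  have hsum : ∀ b : Fin σ'.card → ℝ, ∑ i, b i • x (e.symm i)
      = ∑ j ∈ σ', (if hj : j ∈ σ' then b (e ⟨j, hj⟩) else 0) • x j := by
    intro b
    rw [← Finset.sum_coe_sort σ']
    refine Fintype.sum_equiv e.symm _ _ fun i => ?_
    simp
  refine ⟨σ'.card, fun i => x (e.symm i), ?_, fun a => ⟨?_, ?_⟩⟩
  · have h3 : (σ.card : ℝ) ≤ 100 * (σ'.card : ℝ) ^ 2 := by
      have h4 : Real.sqrt σ.card ≤ 10 * σ'.card := by linarith
      calc (σ.card : ℝ) = Real.sqrt σ.card ^ 2 := (Real.sq_sqrt (by positivity)).symm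
        _ ≤ (10 * (σ'.card : ℝ)) ^ 2 := by gcongr
        _ = _ := by ring
    calc n * Real.log 2 ≤ 2 * σ.card * Real.log R := hσ
      _ ≤ 2 * (100 * (σ'.card : ℝ) ^ 2) * Real.log R := by gcongr
      _ = _ := by ring
  · rw [mul_comm, ← le_div_iff₀ (by positivity),
      pi_norm_le_iff_of_nonneg (div_nonneg (hN.nonneg _) (by positivity))]
    intro i
    rw [le_div_iff₀ (by positivity), Real.norm_eq_abs]
    set j : σ := (e.symm i).1 with hj
    have h3 : u j (∑ i, a i • x (e.symm i)) = a i * r j := by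
      simp only [map_sum, map_smul, hxu, smul_eq_mul]
      rw [Finset.sum_eq_single i]
      · simp [hj]
      · intro b _ hb
        rw [if_neg, mul_zero]
        intro hbj
        exact hb (e.symm.injective (Subtype.ext hbj))
      · simp
    have h4 := hr j j.2
    calc |a i| * (h / 2) ≤ |a i| * r j := by gcongr
      _ = |a i * r j| := by rw [abs_mul, abs_of_pos (a := r j) (by linarith)]
      _ ≤ _ := by
        rw [← h3, huU]
        exact hU _ _
  · refine le_trans (hN.apply_sum_le_of_signed_sums_le (K := 12 * (40 * d)) (fun ε => ?_) a
      (norm_nonneg a) fun i => norm_le_pi_norm a i) (by linarith)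
    rw [hsum]
    refine le_trans (le_of_eq ?_) (hsigned fun j => if hj : j ∈ σ' then ε (e ⟨j, hj⟩) else 1)
    congr 1
    refine Finset.sum_congr rfl fun j hj => ?_
    simp [hj]

end Assembly
/-! ### Spaces with large volume ratio -/

section VolumeRatio

variable {n : ℕ} {N : EuclideanSpace ℝ (Fin n) → ℝ}

/-- If the unit ball of `N` has volume ratio at least `a √n` relative to the image under `L` of the
euclidean ball, then its preimage under `L` has volume at least `(2 a) ^ n`. -/
lemma two_mul_pow_le_volume_of_le_ratio (hn : 0 < n) {a : ℝ} (ha : 0 < a)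
    (L : EuclideanSpace ℝ (Fin n) ≃ₗ[ℝ] EuclideanSpace ℝ (Fin n))
    (h : a * Real.sqrt n ≤ ((volume {x : EuclideanSpace ℝ (Fin n) | N x ≤ 1}).toReal /
      (volume (L '' Metric.closedBall 0 1)).toReal) ^ ((1 : ℝ) / n)) :
    ENNReal.ofReal ((2 * a) ^ n) ≤ volume {x | N (L x) ≤ 1} := by
  have hn' : (0 : ℝ) < n := by exact_mod_cast hn
  have hs : 0 < Real.sqrt n := Real.sqrt_pos.mpr hn'
  have hset : {x | N x ≤ 1} = L '' {x | N (L x) ≤ 1} := by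
    ext x
    constructor
    · intro hx
      exact ⟨L.symm x, by simpa using hx, by simp⟩
    · rintro ⟨y, hy, rfl⟩
      exact hy
  have hdet : 0 < |LinearMap.det (L : EuclideanSpace ℝ (Fin n) →ₗ[ℝ] EuclideanSpace ℝ (Fin n))| :=
    abs_pos.mpr (LinearEquiv.isUnit_det' L).ne_zero
  have himage : ∀ s : Set (EuclideanSpace ℝ (Fin n)), (volume (L '' s)).toReal =
      |LinearMap.det (L : EuclideanSpace ℝ (Fin n) →ₗ[ℝ] EuclideanSpace ℝ (Fin n))|
        * (volume s).toReal := by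
    intro s
    have := Measure.addHaar_image_linearMap volume
      (L : EuclideanSpace ℝ (Fin n) →ₗ[ℝ] EuclideanSpace ℝ (Fin n)) s
    rw [LinearEquiv.coe_coe] at this
    rw [this, ENNReal.toReal_mul, ENNReal.toReal_ofReal hdet.le]
  have hball := pow_two_div_sqrt_le_volume_ball hn
  have hball0 : 0 < (volume (Metric.closedBall (0 : EuclideanSpace ℝ (Fin n)) 1)).toReal :=
    lt_of_lt_of_le (by positivity) hball
  rw [hset, himage, himage, mul_div_mul_left _ _ hdet.ne'] at h
  have h2 := pow_le_pow_left₀ (by positivity) h n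
  rw [← Real.rpow_natCast (_ ^ _) n, ← Real.rpow_mul (by positivity), one_div_mul_cancel hn'.ne',
    Real.rpow_one, le_div_iff₀ hball0] at h2
  refine ENNReal.ofReal_le_of_le_toReal (le_trans ?_ h2)
  calc (2 * a) ^ n = (a * Real.sqrt n) ^ n * (2 / Real.sqrt n) ^ n := by
        rw [← mul_pow]; congr 1; field_simp
    _ ≤ _ := by gcongr

lemma exists_exponent (hn : 2 ≤ n) :
    ∃ d : ℕ, 1 ≤ d ∧ (n : ℝ) * ((1 + n ^ 2) / 2) ≤ 2 ^ d ∧ d * Real.log 2 ≤ 4 * Real.log n := by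
  have hn' : (2 : ℝ) ≤ n := by exact_mod_cast hn
  have h2 : 0 < Real.log 2 := Real.log_pos (by norm_num)
  have hlog : Real.log 2 ≤ Real.log n := Real.log_le_log (by norm_num) hn'
  have hlogn : 0 < Real.log n := h2.trans_le hlog
  refine ⟨⌈3 * Real.log n / Real.log 2⌉₊, Nat.one_le_ceil_iff.mpr (div_pos (by linarith) h2), ?_, ?_⟩
  · have h3 := Nat.le_ceil (3 * Real.log n / Real.log 2)
    rw [div_le_iff₀ h2] at h3
    have h4 : (n : ℝ) ^ 3 ≤ 2 ^ ⌈3 * Real.log n / Real.log 2⌉₊ := by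
      rw [← Real.log_le_log_iff (by positivity) (by positivity), Real.log_pow, Real.log_pow]
      exact_mod_cast h3
    refine le_trans ?_ h4
    nlinarith [sq_nonneg (n : ℝ)]
  · have h3 := (Nat.ceil_lt_add_one (a := 3 * Real.log n / Real.log 2) (by positivity)).le
    calc _ ≤ (3 * Real.log n / Real.log 2 + 1) * Real.log 2 := by gcongr
      _ = 3 * Real.log n + Real.log 2 := by field_simp
      _ ≤ _ := by linarith

/-- The span of a sequence equivalent to the unit vectors of the sup norm is isomorphic to
`Fin m → ℝ`, with the same constants. -/
lemma IsNormFn.exists_span_equiv (hN : IsNormFn N) {m : ℕ} {x : Fin m → EuclideanSpace ℝ (Fin n)}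
    {k K : ℝ} (hk : 0 < k) (h : ∀ a : Fin m → ℝ, k * ‖a‖ ≤ N (∑ i, a i • x i) ∧
      N (∑ i, a i • x i) ≤ K * ‖a‖) :
    ∃ Z : Submodule ℝ (EuclideanSpace ℝ (Fin n)), Module.finrank ℝ Z = m ∧
      ∃ u : Z ≃ₗ[ℝ] (Fin m → ℝ), ∀ z : Z,
        k * ‖u z‖ ≤ N (z : EuclideanSpace ℝ (Fin n)) ∧
          N (z : EuclideanSpace ℝ (Fin n)) ≤ K * ‖u z‖ := by
  have hli : LinearIndependent ℝ x := by
    rw [Fintype.linearIndependent_iff]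
    intro a ha i
    have h1 := (h a).1
    have h0 : N 0 = 0 := by simpa using hN.smul 0 0
    rw [ha, h0] at h1
    have h2 : ‖a‖ = 0 := by nlinarith [norm_nonneg a]
    exact congrFun (norm_eq_zero.mp h2) i
  set b := Module.Basis.span hli with hb
  refine ⟨Submodule.span ℝ (Set.range x), by simpa using finrank_span_eq_card hli, b.equivFun,
    fun z => ?_⟩
  have hz : (z : EuclideanSpace ℝ (Fin n)) = ∑ i, b.equivFun z i • x i := by
    conv_lhs => rw [← b.sum_equivFun z]
    simp [hb, Module.Basis.span_apply]
  have := h (b.equivFun z)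
  rwa [← hz] at this

end VolumeRatio

/-- spaces with large volume ratio contain large cubes. For every
`a > 0` there are `C₁(a), C₂(a) > 0` such that: if `n ≥ 2` and `X = (ℝⁿ, N)` is an
`n`-dimensional Banach space whose volume ratio satisfies `vr(X) ≥ a √n` — i.e. for
every ellipsoid `L(B₂ⁿ)` (`L` an invertible linear map, `B₂ⁿ` the euclidean unit ball)
contained in the unit ball `B_X = {x | N x ≤ 1}` one has
`(Vol B_X / Vol L(B₂ⁿ))^{1/n} ≥ a √n` — then there is a subspace `Z ⊆ ℝⁿ` of dimension
`m ≥ C₁(a) √n` whose Banach–Mazur distance (in the norm `N`) to `l∞^m` (`Fin m → ℝ`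
with the sup norm) is at most `C₂(a) log n`. -/
theorem large_volume_ratio_contains_cube :
    ∀ a : ℝ, 0 < a → ∃ C₁ : ℝ, 0 < C₁ ∧ ∃ C₂ : ℝ, 0 < C₂ ∧
      ∀ (n : ℕ), 2 ≤ n →
      ∀ N : EuclideanSpace ℝ (Fin n) → ℝ,
        (∀ x y, N (x + y) ≤ N x + N y) →
        (∀ (t : ℝ) (x), N (t • x) = |t| * N x) →
        (∀ x, N x = 0 → x = 0) →
      (∀ L : EuclideanSpace ℝ (Fin n) ≃ₗ[ℝ] EuclideanSpace ℝ (Fin n),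
        (L '' Metric.closedBall 0 1) ⊆ {x | N x ≤ 1} →
        a * Real.sqrt n ≤
          ((volume {x : EuclideanSpace ℝ (Fin n) | N x ≤ 1}).toReal /
            (volume (L '' Metric.closedBall 0 1)).toReal) ^ ((1 : ℝ) / n)) →
      ∃ (Z : Submodule ℝ (EuclideanSpace ℝ (Fin n))) (m : ℕ),
        Module.finrank ℝ Z = m ∧ C₁ * Real.sqrt n ≤ m ∧
        ∃ u : Z ≃ₗ[ℝ] (Fin m → ℝ), ∃ K₁ K₂ : ℝ,
          0 < K₁ ∧ 0 < K₂ ∧ K₁ * K₂ ≤ C₂ * Real.log n ∧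
          ∀ z : Z, K₁⁻¹ * ‖u z‖ ≤ N (z : EuclideanSpace ℝ (Fin n)) ∧
            N (z : EuclideanSpace ℝ (Fin n)) ≤ K₂ * ‖u z‖ := by
  intro a ha
  set h : ℝ := a / (8 * Real.exp 1) with hh
  have hh0 : 0 < h := by positivity
  set R : ℕ := (Finset.Icc ⌊-(1 / h)⌋ ⌊1 / h⌋).card + 2 with hR
  have hlogR : 0 < Real.log R := Real.log_pos (by exact_mod_cast (by omega : 1 < R))
  have hlog2 : 0 < Real.log 2 := Real.log_pos (by norm_num)
  refine ⟨Real.sqrt (Real.log 2 / (200 * Real.log R)), Real.sqrt_pos.mpr (by positivity),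
    3840 / (h * Real.log 2), by positivity, ?_⟩
  intro n hn N hadd hsmul hzero hvr
  have hn0 : 0 < n := by omega
  have hN : IsNormFn N := ⟨hadd, hsmul, hzero⟩
  obtain ⟨L, hmax⟩ := hN.exists_isMaximalPosition
  have hN' : IsNormFn fun x => N (L x) := hN.comp_injective L
  have hV := two_mul_pow_le_volume_of_le_ratio hn0 ha L (hvr L (by
    rintro _ ⟨x, hx, rfl⟩
    exact (hmax.le_norm x).trans (by simpa using hx)))
  obtain ⟨U, hU, hUdet⟩ := hmax.exists_matrix hN'
  obtain ⟨d, hd, hnd, hdlog⟩ := exists_exponent hn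
  obtain ⟨m, x, hm, hx⟩ := hmax.exists_cube hN' hn0 hU hh0 (R := R) (d := d) (by
    calc ENNReal.ofReal ((8 * h) ^ n)
        = ENNReal.ofReal ((2 * Real.exp 1)⁻¹ ^ n) * ENNReal.ofReal ((2 * a) ^ n) := by
          rw [← ENNReal.ofReal_mul (by positivity), ← mul_pow]
          congr 2
          rw [hh]
          field_simp
      _ ≤ _ := by gcongr) (by omega) (by omega) hd hnd
  have hd0 : (0 : ℝ) < d := by exact_mod_cast hd
  obtain ⟨Z, hZ, u, hu⟩ := hN.exists_span_equiv (x := fun i => L (x i)) (k := h / 2)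
    (K := 480 * d) (by positivity) (by simpa using hx)
  refine ⟨Z, m, hZ, ?_, u, (h / 2)⁻¹, 480 * d, by positivity, by positivity, ?_, fun z => ?_⟩
  · rw [← Real.sqrt_mul (by positivity)]
    refine Real.sqrt_le_iff.mpr ⟨by positivity, ?_⟩
    rw [div_mul_eq_mul_div, div_le_iff₀ (by positivity)]
    linarith
  · calc (h / 2)⁻¹ * (480 * d) = 960 / (h * Real.log 2) * (d * Real.log 2) := by
          field_simp; norm_num
      _ ≤ 960 / (h * Real.log 2) * (4 * Real.log n) := by gcongr
      _ = _ := by ring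
  · rw [inv_inv]
    exact hu z
end
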